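/- Let T > 0 and let a : [0,T]×ℝ → [0,∞) be a Borel function. Let z₁, z₂ : [0,T] → 𝓜(ℝ) be maps into the finite signed Borel measures on ℝ, each continuous with respect to the weak topology on measures, and let z⁰ ∈ 𝓜(ℝ). Suppose both z₁ and z₂ solve ∂_t z = Δ(a z) in the sense of distributions with initial condition z(0,·) = z⁰. Assume that z := z₁ − z₂ admits for almost every t ∈ [0,T] a density z(t,·) with z ∈ L¹_loc([0,T]×ℝ), and that for every t₀ > 0: (i) ∫_{[t₀,T]×ℝ} |z(t,x)|² dt dx < ∞, (ii) ∫_{[0,T]×ℝ} |a(t,x) z(t,x)| dt dx < ∞, and (iii) ∫_{[t₀,T]×ℝ} |a(t,x) z(t,x)|² dt dx < ∞. Then z₁(t) = z₂(t) for every t ∈ [0,T]. -/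

import Mathlib

open MeasureTheory Set

/-- Integral of a real function against a finite signed Borel measure, defined through the
Jordan decomposition. -/
noncomputable def sintegral {α : Type*} [MeasurableSpace α]
    (μ : MeasureTheory.SignedMeasure α) (f : α → ℝ) : ℝ :=
  (∫ x, f x ∂μ.toJordanDecomposition.posPart) - ∫ x, f x ∂μ.toJordanDecomposition.negPart

section FokkerPlanckUniqueness

open scoped FourierTransform ContDiff ENNReal BoundedContinuousFunction
open ProbabilityTheory

theorem continuous_fourier_of_integrable {f : ℝ → ℂ} (hf : Integrable f) : Continuous (𝓕 f) :=
  VectorFourier.fourierIntegral_continuous Real.continuous_fourierChar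
    (L := innerₗ ℝ) (by fun_prop) hf

theorem fourier_ae_eq_fourier_toLp {f : ℝ → ℂ} (hf : Integrable f) (hf2 : MemLp f 2) :
    𝓕 f =ᵐ[volume] (𝓕 (hf2.toLp f) : Lp ℂ 2 (volume : Measure ℝ)) := by
  refine ae_eq_of_integral_contDiff_smul_eq (continuous_fourier_of_integrable hf).locallyIntegrable
    ((Lp.memLp _).locallyIntegrable (by norm_num)) fun φ hφ hφc => ?_
  let G : SchwartzMap ℝ ℂ := (hφc.comp_left (g := ((↑) : ℝ → ℂ)) (by simp)).toSchwartzMap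
    (Complex.ofRealCLM.contDiff.comp hφ)
  have hG : ∀ x, G x = (φ x : ℂ) := fun x => rfl
  have h1 := congrArg (fun S => S G) (Lp.fourier_toTemperedDistribution_eq (hf2.toLp f))
  simp only [Lp.toTemperedDistribution_apply, TemperedDistribution.fourier_apply] at h1
  have h2 := VectorFourier.integral_fourierIntegral_smul_eq_flip (L := innerₗ ℝ)
    Real.continuous_fourierChar (by fun_prop) hf (G.integrable (μ := volume))
  have h3 : ∫ x, (𝓕 G) x • (hf2.toLp f : ℝ → ℂ) x = ∫ x, f x • (𝓕 (G : ℝ → ℂ)) x := by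
    refine integral_congr_ae ?_
    filter_upwards [hf2.coeFn_toLp] with x hx
    rw [hx, SchwartzMap.fourier_coe, smul_eq_mul, smul_eq_mul, mul_comm]
  have h4 : ∫ x, f x • (𝓕 (G : ℝ → ℂ)) x = ∫ x, 𝓕 f x • G x := by
    rw [flip_innerₗ] at h2
    exact h2.symm
  rw [h3, h4] at h1
  simp only [hG, Complex.real_smul, smul_eq_mul] at h1 ⊢
  rw [← h1]
  exact integral_congr_ae (.of_forall fun x => mul_comm _ _)

theorem memLp_two_fourier {f : ℝ → ℂ} (hf : Integrable f) (hf2 : MemLp f 2) : MemLp (𝓕 f) 2 :=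
  (memLp_congr_ae (fourier_ae_eq_fourier_toLp hf hf2)).2 (Lp.memLp _)

theorem integral_conj_fourier_mul_fourier {f g : ℝ → ℂ} (hf : Integrable f) (hf2 : MemLp f 2)
    (hg : Integrable g) (hg2 : MemLp g 2) :
    ∫ ξ, (starRingEnd ℂ) (𝓕 f ξ) * 𝓕 g ξ = ∫ x, (starRingEnd ℂ) (f x) * g x := by
  have h := Lp.inner_fourier_eq (hf2.toLp f) (hg2.toLp g)
  rw [L2.inner_def, L2.inner_def] at h
  calc _ = _ := integral_congr_ae ?_
    _ = _ := h
    _ = _ := integral_congr_ae ?_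
  · filter_upwards [fourier_ae_eq_fourier_toLp hf hf2, fourier_ae_eq_fourier_toLp hg hg2]
      with x h1 h2
    simp [h1, h2, mul_comm]
  · filter_upwards [hf2.coeFn_toLp, hg2.coeFn_toLp] with x h1 h2
    simp [h1, h2, mul_comm]

theorem integral_norm_sq_fourier {f : ℝ → ℂ} (hf : Integrable f) (hf2 : MemLp f 2) :
    ∫ ξ, ‖𝓕 f ξ‖ ^ 2 = ∫ x, ‖f x‖ ^ 2 := by
  have h := integral_conj_fourier_mul_fourier hf hf2 hf hf2
  simp only [Complex.conj_mul'] at h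
  exact_mod_cast h

theorem sq_primitive_sub_sq_primitive {h : ℝ → ℝ} {α τ β : ℝ} (hατ : α ≤ τ) (hτβ : τ ≤ β)
    (hh : IntervalIntegrable h volume α β) :
    (∫ r in α..β, h r) ^ 2 - (∫ r in α..τ, h r) ^ 2
      = ∫ s in τ..β, 2 * ((∫ r in α..s, h r) * h s) := by
  set u : ℝ → ℝ := fun s => ∫ r in α..s, h r
  have hu : AbsolutelyContinuousOnInterval u α β :=
    hh.absolutelyContinuousOnInterval_intervalIntegral (by simp)
  have hsub : uIcc τ β ⊆ uIcc α β := by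
    rw [uIcc_of_le hτβ, uIcc_of_le (hατ.trans hτβ)]; exact Icc_subset_Icc_left hατ
  have hu' := hu.mono hsub
  have h1 := hu'.integral_deriv_mul_eq_sub hu'
  rw [sq, sq, ← h1]
  refine intervalIntegral.integral_congr_ae ?_
  filter_upwards [hh.ae_hasDerivAt_integral] with x hx hxm
  have := (hx (hsub (uIoc_subset_uIcc hxm)) α (by simp)).deriv
  rw [show deriv u x = h x from this]
  ring

theorem normSq_primitive_sub_normSq_primitive {h : ℝ → ℂ} {α τ β : ℝ} (hατ : α ≤ τ) (hτβ : τ ≤ β)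
    (hh : IntervalIntegrable h volume α β) :
    ‖∫ r in α..β, h r‖ ^ 2 - ‖∫ r in α..τ, h r‖ ^ 2
      = ∫ s in τ..β, 2 * ((starRingEnd ℂ) (∫ r in α..s, h r) * h s).re := by
  have hre : IntervalIntegrable (fun r => (h r).re) volume α β := ⟨hh.1.re, hh.2.re⟩
  have him : IntervalIntegrable (fun r => (h r).im) volume α β := ⟨hh.1.im, hh.2.im⟩
  have hsub : ∀ s ∈ uIcc α β, uIcc α s ⊆ uIcc α β := fun s hs => uIcc_subset_uIcc_left hs
  have hs1 : ∀ s ∈ uIcc α β, (∫ r in α..s, h r).re = ∫ r in α..s, (h r).re := fun s hs => by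
    have := Complex.reCLM.intervalIntegral_comp_comm (hh.mono_set (hsub s hs))
    simpa using this.symm
  have hs2 : ∀ s ∈ uIcc α β, (∫ r in α..s, h r).im = ∫ r in α..s, (h r).im := fun s hs => by
    have := Complex.imCLM.intervalIntegral_comp_comm (hh.mono_set (hsub s hs))
    simpa using this.symm
  have hτ : τ ∈ uIcc α β := by rw [uIcc_of_le (hατ.trans hτβ)]; exact ⟨hατ, hτβ⟩
  have hτs : uIcc τ β ⊆ uIcc α β := uIcc_subset_uIcc_right hτ
  have key : ∀ g : ℝ → ℝ, IntervalIntegrable g volume α β →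
      IntervalIntegrable (fun s => 2 * ((∫ r in α..s, g r) * g s)) volume τ β := fun g hg => by
    have hc : ContinuousOn (fun s => ∫ r in α..s, g r) (uIcc α β) :=
      intervalIntegral.continuousOn_primitive_interval' hg (by simp)
    exact ((hg.mono_set hτs).continuousOn_mul (hc.mono hτs)).const_mul 2
  simp only [← Complex.normSq_eq_norm_sq, Complex.normSq_apply]
  rw [hs1 β (by simp), hs2 β (by simp), hs1 τ hτ, hs2 τ hτ]
  have e1 := sq_primitive_sub_sq_primitive hατ hτβ hre
  have e2 := sq_primitive_sub_sq_primitive hατ hτβ him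
  calc _ = (∫ s in τ..β, 2 * ((∫ r in α..s, (h r).re) * (h s).re))
      + ∫ s in τ..β, 2 * ((∫ r in α..s, (h r).im) * (h s).im) := by rw [← e1, ← e2]; ring
    _ = _ := by
      rw [← intervalIntegral.integral_add (key _ hre) (key _ him)]
      refine intervalIntegral.integral_congr fun s hs => ?_
      simp only [Complex.mul_re, Complex.conj_re, Complex.conj_im]
      rw [hs1 s (hτs hs), hs2 s (hτs hs)]
      ring

theorem stronglyMeasurable_fourier_ofReal {K : ℝ → ℝ → ℝ} (hK : Measurable (Function.uncurry K)) :
    StronglyMeasurable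
      (Function.uncurry fun r ξ : ℝ => 𝓕 (fun x => ((K r x : ℝ) : ℂ)) ξ) := by
  have h : (Function.uncurry fun r ξ : ℝ => 𝓕 (fun x => ((K r x : ℝ) : ℂ)) ξ)
      = fun p : ℝ × ℝ =>
        ∫ x, Complex.exp (↑(-2 * Real.pi * x * p.2) * Complex.I) * (K p.1 x : ℂ) := by
    ext p
    simp [Function.uncurry, Real.fourier_real_eq_integral_exp_smul]
  rw [h]
  refine StronglyMeasurable.integral_prod_right
    (f := fun (p : ℝ × ℝ) x =>
      Complex.exp (↑(-2 * Real.pi * x * p.2) * Complex.I) * (K p.1 x : ℂ)) ?_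
  refine Measurable.stronglyMeasurable ?_
  have h1 : Measurable fun q : (ℝ × ℝ) × ℝ => K q.1.1 q.2 :=
    hK.comp (measurable_fst.fst.prodMk measurable_snd)
  have h2 : Continuous fun q : (ℝ × ℝ) × ℝ =>
      Complex.exp (↑(-2 * Real.pi * q.2 * q.1.2) * Complex.I) := by fun_prop
  exact h2.measurable.mul (Complex.measurable_ofReal.comp h1)

theorem norm_fourier_ofReal_le (f : ℝ → ℝ) (ξ : ℝ) :
    ‖𝓕 (fun x => (f x : ℂ)) ξ‖ ≤ ∫ x, |f x| := by
  have := VectorFourier.norm_fourierIntegral_le_integral_norm Real.fourierChar volume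
    (innerₗ ℝ) (fun x => (f x : ℂ)) ξ
  exact this.trans_eq (by simp)

theorem integrable_normSq_fourier {μ : Measure ℝ} [SFinite μ] {K : ℝ → ℝ → ℝ}
    (hK : Measurable (Function.uncurry K))
    (hK1 : ∀ᵐ s ∂μ, Integrable (K s))
    (hK2 : Integrable (fun q : ℝ × ℝ => K q.1 q.2 ^ 2) (μ.prod volume)) :
    (∀ᵐ s ∂μ, MemLp (fun x => (K s x : ℂ)) 2) ∧
    Integrable (fun q : ℝ × ℝ => ‖𝓕 (fun x => (K q.1 x : ℂ)) q.2‖ ^ 2) (μ.prod volume) := by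
  have hmem : ∀ᵐ s ∂μ, MemLp (fun x => (K s x : ℂ)) 2 := by
    filter_upwards [hK2.prod_right_ae] with s hs
    have hm : Measurable (K s) := hK.comp measurable_prodMk_left
    refine (memLp_two_iff_integrable_sq_norm
      (Complex.measurable_ofReal.comp hm).aestronglyMeasurable).2 ?_
    simpa using hs
  refine ⟨hmem, ?_⟩
  have hsm := stronglyMeasurable_fourier_ofReal hK
  refine (integrable_prod_iff (hsm.norm.pow 2).aestronglyMeasurable).2 ⟨?_, ?_⟩
  · filter_upwards [hmem, hK1] with s hs hs1
    exact (memLp_two_fourier hs1.ofReal hs).integrable_norm_pow (by norm_num)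
  · refine hK2.integral_prod_left.congr ?_
    filter_upwards [hmem, hK1] with s hs hs1
    have := integral_norm_sq_fourier hs1.ofReal hs
    simpa using this.symm

open Filter Topology in
theorem energy_uniqueness {α β : ℝ} (hαβ : α < β) {g K : ℝ → ℝ → ℝ}
    (hg : Measurable (Function.uncurry g)) (hK : Measurable (Function.uncurry K))
    (hK1 : Integrable (fun q : ℝ × ℝ => K q.1 q.2) ((volume.restrict (Ioc α β)).prod volume))
    (hg1 : ∀ᵐ s ∂volume.restrict (Ioc α β), Integrable (g s))
    (hg2 : ∀ τ, α < τ →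
      Integrable (fun q : ℝ × ℝ => g q.1 q.2 ^ 2) ((volume.restrict (Ioc τ β)).prod volume))
    (hK2 : ∀ τ, α < τ →
      Integrable (fun q : ℝ × ℝ => K q.1 q.2 ^ 2) ((volume.restrict (Ioc τ β)).prod volume))
    (hpos : ∀ᵐ s ∂volume.restrict (Ioc α β), ∀ᵐ x, 0 ≤ K s x * g s x)
    {Z : ℝ → ℝ → ℂ} {C : ℝ} (hC : ∀ s ∈ Icc α β, ∀ ξ, ‖Z s ξ‖ ≤ C)
    (hZ : ∀ s ∈ Icc α β, ∀ ξ, Z s ξ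
      = -((4 * Real.pi ^ 2 * ξ ^ 2 : ℝ) : ℂ) * ∫ r in α..s, 𝓕 (fun x => (K r x : ℂ)) ξ)
    (hZg : ∀ᵐ s ∂volume.restrict (Ioc α β), ∀ ξ, Z s ξ = 𝓕 (fun x => (g s x : ℂ)) ξ) :
    ∀ᵐ ξ, Z β ξ = 0 := by
  set k : ℝ → ℝ → ℂ := fun r ξ => 𝓕 (fun x => (K r x : ℂ)) ξ with hk
  set U : ℝ → ℝ → ℂ := fun s ξ => ∫ r in α..s, k r ξ with hU
  set c : ℝ := 4 * Real.pi ^ 2 with hc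
  have hcpos : 1 ≤ c := by rw [hc]; nlinarith [Real.pi_gt_three]
  set A : ℝ → ℝ := fun r => ∫ x, |K r x|
  have hA : IntervalIntegrable A volume α β :=
    (intervalIntegrable_iff_integrableOn_Ioc_of_le hαβ.le).2 hK1.norm.integral_prod_left
  have hA0 : ∀ r, 0 ≤ A r := fun r => integral_nonneg fun x => abs_nonneg _
  have hkA : ∀ r ξ, ‖k r ξ‖ ≤ A r := fun r ξ => norm_fourier_ofReal_le _ _
  have hkm : StronglyMeasurable (Function.uncurry k) := stronglyMeasurable_fourier_ofReal hK
  have hki : ∀ ξ, IntervalIntegrable (fun r => k r ξ) volume α β := fun ξ =>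
    hA.mono_fun (hkm.comp_measurable (measurable_id.prodMk measurable_const)).aestronglyMeasurable
      (.of_forall fun r => by
        simpa only [Real.norm_eq_abs, abs_of_nonneg (hA0 r)] using hkA r ξ)
  set M : ℝ := ∫ r in α..β, A r
  have hUM : ∀ s ∈ Icc α β, ∀ ξ, ‖U s ξ‖ ≤ M := fun s hs ξ => by
    have hAs : IntervalIntegrable A volume α s := hA.mono_set (by
      rw [uIcc_of_le hs.1, uIcc_of_le hαβ.le]; exact Icc_subset_Icc_right hs.2)
    calc ‖U s ξ‖ ≤ ∫ r in α..s, A r := 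
          intervalIntegral.norm_integral_le_of_norm_le hs.1 (.of_forall fun r _ => hkA r ξ) hAs
      _ ≤ M := intervalIntegral.integral_mono_interval le_rfl hs.1 hs.2
          (.of_forall hA0) hA
  have hM0 : 0 ≤ M := (norm_nonneg _).trans (hUM α ⟨le_rfl, hαβ.le⟩ 0)
  have hUC : ∀ s ∈ Icc α β, ∀ ξ, c * ξ ^ 2 * ‖U s ξ‖ ≤ C := fun s hs ξ => by
    have := hC s hs ξ
    rwa [hZ s hs ξ, norm_mul, norm_neg, Complex.norm_real, Real.norm_of_nonneg (by positivity)]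
      at this
  have hC0 : 0 ≤ C := (norm_nonneg _).trans (hC α ⟨le_rfl, hαβ.le⟩ 0)
  set q : ℝ → ℝ → ℝ := fun s ξ => ξ ^ 2 * ‖U s ξ‖ ^ 2 with hq
  have hqb : ∀ s ∈ Icc α β, ∀ ξ, ‖q s ξ‖ ≤ (C ^ 2 + M * C) * (1 + ξ ^ 2)⁻¹ := fun s hs ξ => by
    have h1 := hUM s hs ξ
    have h2 : ξ ^ 2 * ‖U s ξ‖ ≤ C := le_trans (by
      rw [mul_assoc]; exact le_mul_of_one_le_left (by positivity) hcpos) (hUC s hs ξ)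
    rw [Real.norm_of_nonneg (by positivity), ← div_eq_mul_inv, le_div_iff₀ (by positivity)]
    have h3 : (ξ ^ 2 * ‖U s ξ‖) ^ 2 ≤ C ^ 2 := by gcongr
    have h4 : ‖U s ξ‖ * (ξ ^ 2 * ‖U s ξ‖) ≤ M * C := by gcongr
    simp only [hq]
    nlinarith
  have hUm : ∀ s, α ≤ s → StronglyMeasurable (U s) := fun s hs => by
    simp only [hU, intervalIntegral.integral_of_le hs]
    exact hkm.integral_prod_left
  have hqm : ∀ s ∈ Icc α β, AEStronglyMeasurable (q s) volume := fun s hs =>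
    ((continuous_pow 2).stronglyMeasurable.mul ((hUm s hs.1).norm.pow 2)).aestronglyMeasurable
  have hbi : Integrable fun ξ : ℝ => (C ^ 2 + M * C) * (1 + ξ ^ 2)⁻¹ :=
    integrable_inv_one_add_sq.const_mul _
  have hqi : ∀ s ∈ Icc α β, Integrable (q s) := fun s hs =>
    hbi.mono' (hqm s hs) (.of_forall (hqb s hs))
  have hmono : ∀ τ ∈ Ioc α β, ∫ ξ, q β ξ ≤ ∫ ξ, q τ ξ := by
    intro τ hτ
    have hτs : Ioc τ β ⊆ Ioc α β := Ioc_subset_Ioc_left hτ.1.le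
    have hres := ae_mono (Measure.restrict_mono hτs (le_refl (volume : Measure ℝ)))
    have hK1' : ∀ᵐ s ∂volume.restrict (Ioc τ β), Integrable (K s) := hres hK1.prod_right_ae
    have hg1' : ∀ᵐ s ∂volume.restrict (Ioc τ β), Integrable (g s) := hres hg1
    obtain ⟨hKm, hKi⟩ := integrable_normSq_fourier hK hK1' (hK2 τ hτ.1)
    obtain ⟨hgm, hgi⟩ := integrable_normSq_fourier hg hg1' (hg2 τ hτ.1)
    have hgsm := stronglyMeasurable_fourier_ofReal hg
    set G : ℝ → ℝ → ℂ := fun r ξ => 𝓕 (fun x => (g r x : ℂ)) ξ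
    have hinteg : Integrable (Function.uncurry fun r ξ => ((starRingEnd ℂ) (G r ξ) * k r ξ).re)
        ((volume.restrict (Ioc τ β)).prod volume) := by
      refine (hKi.add hgi).mono' ?_ (.of_forall fun p => ?_)
      · exact (Complex.continuous_re.comp_stronglyMeasurable
          ((Complex.continuous_conj.comp_stronglyMeasurable hgsm).mul hkm)).aestronglyMeasurable
      · simp only [Function.uncurry, Pi.add_apply]
        refine (Complex.abs_re_le_norm _).trans ?_
        rw [norm_mul, RCLike.norm_conj]
        nlinarith [sq_nonneg (‖G p.1 p.2‖ - ‖k p.1 p.2‖), sq_nonneg (‖G p.1 p.2‖),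
          sq_nonneg (‖k p.1 p.2‖)]
    have hpt : ∀ ξ, q β ξ - q τ ξ
        = -(2 / c) * ∫ r in Ioc τ β, ((starRingEnd ℂ) (G r ξ) * k r ξ).re := fun ξ => by
      simp only [hq]
      rw [← mul_sub, normSq_primitive_sub_normSq_primitive hτ.1.le hτ.2 (hki ξ),
        intervalIntegral.integral_of_le hτ.2, ← integral_const_mul, ← integral_const_mul]
      refine integral_congr_ae ?_
      filter_upwards [hres hZg, ae_restrict_mem measurableSet_Ioc] with r hr hrm
      have hrI : r ∈ Icc α β := ⟨(hτ.1.trans hrm.1).le, hrm.2⟩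
      have e := hr ξ
      rw [hZ r hrI ξ] at e
      change _ = -(2 / c) * ((starRingEnd ℂ) (G r ξ) * k r ξ).re
      rw [show G r ξ = _ from e.symm]
      change ξ ^ 2 * (2 * ((starRingEnd ℂ) (U r ξ) * k r ξ).re)
        = -(2 / c) * ((starRingEnd ℂ) (-((c * ξ ^ 2 : ℝ) : ℂ) * U r ξ) * k r ξ).re
      rw [← Complex.ofReal_neg, map_mul, Complex.conj_ofReal, mul_assoc, Complex.re_ofReal_mul]
      field_simp
    have hfin : ∫ ξ, ∫ r in Ioc τ β, ((starRingEnd ℂ) (G r ξ) * k r ξ).re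
        = ∫ r in Ioc τ β, ∫ ξ, ((starRingEnd ℂ) (G r ξ) * k r ξ).re :=
      (integral_integral_swap hinteg).symm
    have hnn : 0 ≤ ∫ r in Ioc τ β, ∫ ξ, ((starRingEnd ℂ) (G r ξ) * k r ξ).re := by
      refine integral_nonneg_of_ae ?_
      filter_upwards [hKm, hgm, hK1', hg1', hres hpos] with r h1 h2 h3 h4 h5
      have e := integral_conj_fourier_mul_fourier h4.ofReal h2 h3.ofReal h1
      have hi : Integrable fun ξ => (starRingEnd ℂ) (G r ξ) * k r ξ :=
        (memLp_two_fourier h4.ofReal h2).star.integrable_mul (memLp_two_fourier h3.ofReal h1)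
      have e2 : ∫ ξ, ((starRingEnd ℂ) (G r ξ) * k r ξ).re = ∫ x, K r x * g r x := by
        have := integral_re hi
        rw [show (∫ ξ, ((starRingEnd ℂ) (G r ξ) * k r ξ).re) = _ from this,
          show (∫ ξ, (starRingEnd ℂ) (G r ξ) * k r ξ) = _ from e]
        change (∫ x, (starRingEnd ℂ) (g r x : ℂ) * (K r x : ℂ)).re = _
        simp only [Complex.conj_ofReal, ← Complex.ofReal_mul]
        rw [integral_complex_ofReal, Complex.ofReal_re]
        simp only [mul_comm]
      simp only [Pi.zero_apply]
      rw [e2]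
      exact integral_nonneg_of_ae h5
    have hβ : β ∈ Icc α β := ⟨hαβ.le, le_rfl⟩
    have : ∫ ξ, (q β ξ - q τ ξ) ≤ 0 := by
      simp only [hpt]
      rw [integral_const_mul, hfin]
      have : 0 ≤ 2 / c := by positivity
      nlinarith
    rw [integral_sub (hqi β hβ) (hqi τ ⟨hτ.1.le, hτ.2⟩)] at this
    linarith
  have hlim : Tendsto (fun τ => ∫ ξ, q τ ξ) (𝓝[Ioc α β] α) (𝓝 (∫ _ : ℝ, (0:ℝ))) := by
    have hmem : ∀ᶠ τ in 𝓝[Ioc α β] α, τ ∈ Icc α β :=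
      eventually_nhdsWithin_of_forall fun τ hτ => Ioc_subset_Icc_self hτ
    refine tendsto_integral_filter_of_dominated_convergence _
      (hmem.mono hqm) (hmem.mono fun τ hτ => .of_forall (hqb τ hτ)) hbi (.of_forall fun ξ => ?_)
    have hcont : ContinuousOn (fun s => U s ξ) (uIcc α β) :=
      intervalIntegral.continuousOn_primitive_interval' (hki ξ) (by simp)
    have h0 : Tendsto (fun s => U s ξ) (𝓝[Ioc α β] α) (𝓝 (U α ξ)) :=
      (hcont α (by simp)).mono_left
        (nhdsWithin_mono _ (by rw [uIcc_of_le hαβ.le]; exact Ioc_subset_Icc_self))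
    have hUα : U α ξ = 0 := by simp [hU]
    rw [hUα] at h0
    simpa [hq] using (h0.norm.pow 2).const_mul (ξ ^ 2)
  have hNe : (𝓝[Ioc α β] α).NeBot := by
    rw [nhdsWithin_Ioc_eq_nhdsGT hαβ]; infer_instance
  have hle : ∫ ξ, q β ξ ≤ 0 := by
    rw [integral_zero] at hlim
    exact ge_of_tendsto hlim (eventually_nhdsWithin_of_forall hmono)
  have hβ : β ∈ Icc α β := ⟨hαβ.le, le_rfl⟩
  have hq0 : ∀ ξ, 0 ≤ q β ξ := fun ξ => by positivity
  have hz := (integral_eq_zero_iff_of_nonneg hq0 (hqi β hβ)).1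
    (le_antisymm hle (integral_nonneg hq0))
  filter_upwards [hz] with ξ hξ
  rw [hZ β hβ ξ]
  simp only [hq, Pi.zero_apply, mul_eq_zero, pow_eq_zero_iff, ne_eq, OfNat.ofNat_ne_zero,
    not_false_eq_true, norm_eq_zero] at hξ
  rcases hξ with h | h
  · simp [h]
  · rw [show (∫ r in α..β, 𝓕 (fun x => (K r x : ℂ)) ξ) = U β ξ from rfl, h, mul_zero]

open Filter Topology in
theorem energy_uniqueness_of_dichotomy {T : ℝ} {g K : ℝ → ℝ → ℝ}
    (hg : Measurable (Function.uncurry g)) (hK : Measurable (Function.uncurry K))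
    (hK1 : Integrable (fun q : ℝ × ℝ => K q.1 q.2) ((volume.restrict (Ioc 0 T)).prod volume))
    (hg1 : ∀ᵐ s ∂volume.restrict (Ioc 0 T), Integrable (g s))
    (hg2 : ∀ τ, 0 < τ →
      Integrable (fun q : ℝ × ℝ => g q.1 q.2 ^ 2) ((volume.restrict (Ioc τ T)).prod volume))
    (hK2 : ∀ τ, 0 < τ →
      Integrable (fun q : ℝ × ℝ => K q.1 q.2 ^ 2) ((volume.restrict (Ioc τ T)).prod volume))
    (hpos : ∀ᵐ s ∂volume.restrict (Ioc 0 T), ∀ᵐ x, 0 ≤ K s x * g s x)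
    {Z : ℝ → ℝ → ℂ} {C : ℝ} (hC : ∀ s ∈ Icc 0 T, ∀ ξ, ‖Z s ξ‖ ≤ C)
    (hZt : ∀ ξ, ContinuousOn (fun s => Z s ξ) (Icc 0 T))
    (hZx : ∀ s ∈ Icc 0 T, Continuous (Z s)) (hZ0 : ∀ ξ, Z 0 ξ = 0)
    (hZ : ∀ s ∈ Icc 0 T, (∀ ξ, Z s ξ = 0) ∨ ∀ ξ, Z s ξ
      = -((4 * Real.pi ^ 2 * ξ ^ 2 : ℝ) : ℂ) * ∫ r in 0..s, 𝓕 (fun x => (K r x : ℂ)) ξ)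
    (hZg : ∀ᵐ s ∂volume.restrict (Ioc 0 T), ∀ ξ, Z s ξ = 𝓕 (fun x => (g s x : ℂ)) ξ) :
    ∀ t ∈ Icc 0 T, ∀ ξ, Z t ξ = 0 := by
  intro t ht
  by_contra hne
  set S : Set ℝ := {s ∈ Icc 0 t | ∀ ξ, Z s ξ = 0} with hS
  have htT : Icc 0 t ⊆ Icc 0 T := Icc_subset_Icc_right ht.2
  have hSc : IsClosed S := by
    have : S = ⋂ ξ, Icc 0 t ∩ (fun s => Z s ξ) ⁻¹' {0} := by
      ext s; simp [hS, forall_and]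
    rw [this]
    exact isClosed_iInter fun ξ =>
      ((hZt ξ).mono htT).preimage_isClosed_of_isClosed isClosed_Icc isClosed_singleton
  have hScomp : IsCompact S := isCompact_Icc.of_isClosed_subset hSc (sep_subset _ _)
  have h0S : (0:ℝ) ∈ S := ⟨⟨le_rfl, ht.1⟩, hZ0⟩
  set α := sSup S
  have hαS : α ∈ S := hScomp.sSup_mem ⟨0, h0S⟩
  have hα0 : 0 ≤ α := hαS.1.1
  have hαt : α < t := lt_of_le_of_ne hαS.1.2 fun h => hne (h ▸ hαS.2)
  have hgt : ∀ s, α < s → s ≤ t → s ∉ S := fun s hs _ hsS =>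
    absurd (le_csSup hScomp.bddAbove hsS) (not_le.2 hs)
  have hL : ∀ s ∈ Ioc α t, ∀ ξ, Z s ξ
      = -((4 * Real.pi ^ 2 * ξ ^ 2 : ℝ) : ℂ) * ∫ r in 0..s, 𝓕 (fun x => (K r x : ℂ)) ξ := by
    intro s hs
    have hs0 : s ∈ Icc 0 t := ⟨hα0.trans hs.1.le, hs.2⟩
    exact (hZ s (htT hs0)).resolve_left fun h => hgt s hs.1 hs.2 ⟨hs0, h⟩
  have hA : IntervalIntegrable (fun r => ∫ x, |K r x|) volume 0 T :=
    (intervalIntegrable_iff_integrableOn_Ioc_of_le (ht.1.trans ht.2)).2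
      hK1.norm.integral_prod_left
  have hki : ∀ ξ, IntervalIntegrable (fun r => 𝓕 (fun x => (K r x : ℂ)) ξ) volume 0 T := fun ξ =>
    hA.mono_fun ((stronglyMeasurable_fourier_ofReal hK).comp_measurable
      (measurable_id.prodMk measurable_const)).aestronglyMeasurable
      (.of_forall fun r => by
        beta_reduce
        rw [Real.norm_of_nonneg (integral_nonneg fun x => abs_nonneg _)]
        exact norm_fourier_ofReal_le _ ξ)
  have hkis : ∀ s ∈ Icc 0 t, ∀ ξ,
      IntervalIntegrable (fun r => 𝓕 (fun x => (K r x : ℂ)) ξ) volume 0 s := fun s hs ξ =>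
    (hki ξ).mono_set (by
      rw [uIcc_of_le hs.1, uIcc_of_le (ht.1.trans ht.2)]
      exact Icc_subset_Icc_right (hs.2.trans ht.2))
  have hLα : ∀ ξ, -((4 * Real.pi ^ 2 * ξ ^ 2 : ℝ) : ℂ)
      * ∫ r in 0..α, 𝓕 (fun x => (K r x : ℂ)) ξ = 0 := by
    intro ξ
    have hNe : (𝓝[Ioc α t] α).NeBot := by
      rw [nhdsWithin_Ioc_eq_nhdsGT hαt]; infer_instance
    have hsub : Ioc α t ⊆ Icc 0 T := fun s hs => htT ⟨hα0.trans hs.1.le, hs.2⟩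
    have hcont : ContinuousOn (fun s => ∫ r in 0..s, 𝓕 (fun x => (K r x : ℂ)) ξ) (uIcc 0 T) :=
      intervalIntegral.continuousOn_primitive_interval' (hki ξ) (by simp)
    rw [uIcc_of_le (ht.1.trans ht.2)] at hcont
    have h1 := ((hcont α (htT hαS.1)).mono_left (nhdsWithin_mono _ hsub)).const_mul
      (-((4 * Real.pi ^ 2 * ξ ^ 2 : ℝ) : ℂ))
    have h2 := (hZt ξ α (htT hαS.1)).mono_left (nhdsWithin_mono _ hsub)
    rw [← hαS.2 ξ]
    exact tendsto_nhds_unique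
      (h1.congr' (eventually_nhdsWithin_of_forall fun s hs => (hL s hs ξ).symm)) h2
  have hZα : ∀ s ∈ Icc α t, ∀ ξ, Z s ξ
      = -((4 * Real.pi ^ 2 * ξ ^ 2 : ℝ) : ℂ) * ∫ r in α..s, 𝓕 (fun x => (K r x : ℂ)) ξ := by
    intro s hs ξ
    rcases hs.1.eq_or_lt with rfl | hlt
    · simp [hαS.2 ξ]
    · rw [hL s ⟨hlt, hs.2⟩ ξ, ← intervalIntegral.integral_interval_sub_left
        (hkis s ⟨hα0.trans hs.1, hs.2⟩ ξ) (hkis α hαS.1 ξ), mul_sub, hLα, sub_zero]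
  have hsub : Ioc α t ⊆ Ioc 0 T := fun s hs => ⟨hα0.trans_lt hs.1, hs.2.trans ht.2⟩
  have hres := ae_mono (Measure.restrict_mono hsub (le_refl (volume : Measure ℝ)))
  have hmono : ∀ τ, α < τ → (volume.restrict (Ioc τ t)).prod (volume : Measure ℝ)
      ≤ (volume.restrict (Ioc τ T)).prod volume := fun τ _ =>
    Measure.prod_mono (Measure.restrict_mono (Ioc_subset_Ioc_right ht.2) le_rfl) le_rfl
  have hae := energy_uniqueness hαt hg hK
    (hK1.mono_measure (Measure.prod_mono (Measure.restrict_mono hsub le_rfl) le_rfl))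
    (hres hg1) (fun τ hτ => (hg2 τ (hα0.trans_lt hτ)).mono_measure (hmono τ hτ))
    (fun τ hτ => (hK2 τ (hα0.trans_lt hτ)).mono_measure (hmono τ hτ)) (hres hpos)
    (fun s hs => hC s (htT ⟨hα0.trans hs.1, hs.2⟩)) hZα (hres hZg)
  have := (hZx t ht).ae_eq_iff_eq volume (continuous_const (y := (0:ℂ)))
  exact hne fun ξ => congrFun (this.1 hae) ξ

theorem sintegral_neg {α : Type*} [MeasurableSpace α] (μ : SignedMeasure α) (f : α → ℝ) :
    sintegral (-μ) f = -sintegral μ f := by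
  simp [sintegral, SignedMeasure.toJordanDecomposition_neg]

theorem ofReal_lt_posPart_apply_iff {μ : SignedMeasure ℝ} {U : Set ℝ} (hU : IsOpen U) {r : ℝ}
    (hr : 0 ≤ r) : ENNReal.ofReal r < μ.toJordanDecomposition.posPart U ↔
      ∃ f : ℝ →ᵇ ℝ, (∀ x, f x ∈ Icc (0:ℝ) 1) ∧ (∀ x ∉ U, f x = 0) ∧ r < sintegral μ f := by
  set P := μ.toJordanDecomposition.posPart with hP
  set N := μ.toJordanDecomposition.negPart with hN
  constructor
  · intro h
    obtain ⟨S, hS, hPS, hNS⟩ := μ.toJordanDecomposition.mutuallySingular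
    have h1 : ENNReal.ofReal r < P (U ∩ Sᶜ) := by
      rwa [measure_inter_conull (by simpa using hPS)]
    obtain ⟨K, hKU, hK, hrK⟩ := (hU.measurableSet.inter hS.compl).exists_lt_isCompact h1
    have hNK : N K = 0 := measure_mono_null (hKU.trans inter_subset_right) hNS
    have hrK' : r < P.real K :=
      (ENNReal.ofReal_lt_iff_lt_toReal hr (measure_ne_top _ _)).1 hrK
    obtain ⟨V, hKV, hV, hNV⟩ := K.exists_isOpen_lt_of_lt (μ := N) (ENNReal.ofReal (P.real K - r))
      (by rw [hNK]; simpa using hrK')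
    obtain ⟨f, hf0, hf1, hf⟩ := exists_continuous_zero_one_of_isClosed
      (hV.inter hU).isClosed_compl hK.isClosed (by
        rw [disjoint_compl_left_iff_subset]
        exact subset_inter hKV (hKU.trans inter_subset_left))
    have hf' : ∀ x, ‖f x‖ ≤ 1 := fun x => by
      rw [Real.norm_of_nonneg (hf x).1]; exact (hf x).2
    refine ⟨BoundedContinuousFunction.ofNormedAddCommGroup f f.continuous 1 hf', hf,
      fun x hx => hf0 fun h => hx h.2, ?_⟩
    have hfi : ∀ (ν : Measure ℝ) [IsFiniteMeasure ν], Integrable f ν := fun ν _ =>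
      .of_bound f.continuous.aestronglyMeasurable 1 (.of_forall hf')
    have e1 : P.real K ≤ ∫ x, f x ∂P := by
      rw [← integral_indicator_one hK.measurableSet]
      refine integral_mono ((integrable_const 1).indicator hK.measurableSet) (hfi P) fun x => ?_
      by_cases hx : x ∈ K
      · simp [hx, hf1 hx]
      · simpa [hx] using (hf x).1
    have e2 : ∫ x, f x ∂N ≤ N.real V := by
      rw [← integral_indicator_one hV.measurableSet]
      refine integral_mono (hfi N) ((integrable_const 1).indicator hV.measurableSet) fun x => ?_
      by_cases hx : x ∈ V
      · simpa [hx] using (hf x).2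
      · simp [hx, hf0 (show x ∈ (V ∩ U)ᶜ from fun h => hx h.1)]
    have e3 : N.real V < P.real K - r :=
      (ENNReal.lt_ofReal_iff_toReal_lt (measure_ne_top _ _)).1 hNV
    change r < (∫ x, f x ∂P) - ∫ x, f x ∂N
    linarith
  · rintro ⟨f, hf, hfU, hrf⟩
    rw [ENNReal.ofReal_lt_iff_lt_toReal hr (measure_ne_top _ _)]
    refine hrf.trans_le ?_
    have e1 : ∫ x, f x ∂P ≤ P.real U := by
      rw [← integral_indicator_one hU.measurableSet]
      refine integral_mono (f.integrable P) ((integrable_const 1).indicator hU.measurableSet)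
        fun x => ?_
      by_cases hx : x ∈ U
      · simpa [hx] using (hf x).2
      · simp [hx, hfU x hx]
    have e2 : 0 ≤ ∫ x, f x ∂N := integral_nonneg fun x => (hf x).1
    change (∫ x, f x ∂P) - ∫ x, f x ∂N ≤ P.real U
    linarith

theorem measurable_jordan_posPart {z : ℝ → SignedMeasure ℝ}
    (hz : ∀ φ : ℝ →ᵇ ℝ, Continuous fun t => sintegral (z t) φ) :
    Measurable fun t => (z t).toJordanDecomposition.posPart := by
  have h : ∀ U : Set ℝ, IsOpen U →
      Measurable fun t => (z t).toJordanDecomposition.posPart U := by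
    intro U hU
    refine measurable_of_Ioi fun r => ?_
    rcases eq_or_ne r ⊤ with rfl | hr
    · simp
    lift r to NNReal using hr
    have : (fun t => (z t).toJordanDecomposition.posPart U) ⁻¹' Ioi (r : ℝ≥0∞)
        = ⋃ f : {f : ℝ →ᵇ ℝ // (∀ x, f x ∈ Icc (0:ℝ) 1) ∧ ∀ x ∉ U, f x = 0},
          (fun t => sintegral (z t) f.1) ⁻¹' Ioi (r : ℝ) := by
      ext t
      have := ofReal_lt_posPart_apply_iff (μ := z t) hU r.2
      rw [NNReal.val_eq_coe, ENNReal.ofReal_coe_nnreal] at this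
      simp only [mem_preimage, mem_Ioi, this, mem_iUnion, Subtype.exists, exists_prop, and_assoc]
    rw [this]
    exact (isOpen_iUnion fun _ => isOpen_Ioi.preimage (hz _)).measurableSet
  exact Measurable.measure_of_isPiSystem (BorelSpace.measurable_eq (α := ℝ)) isPiSystem_isOpen
    h (h univ isOpen_univ)

theorem exists_bound_sintegral {z : ℝ → SignedMeasure ℝ}
    (hz : ∀ φ : ℝ →ᵇ ℝ, ∃ C, ∀ t, |sintegral (z t) φ| ≤ C) :
    ∃ C, 0 ≤ C ∧ ∀ t, ∀ φ : ℝ →ᵇ ℝ, |sintegral (z t) φ| ≤ C * ‖φ‖ := by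
  let L : ℝ → (ℝ →ᵇ ℝ) →L[ℝ] ℝ := fun t =>
    LinearMap.mkContinuous
      { toFun := fun φ => sintegral (z t) φ
        map_add' := fun φ ψ => by
          simp only [sintegral, BoundedContinuousFunction.coe_add, Pi.add_apply]
          rw [integral_add (φ.integrable _) (ψ.integrable _),
            integral_add (φ.integrable _) (ψ.integrable _)]
          ring
        map_smul' := fun c φ => by
          simp only [sintegral, BoundedContinuousFunction.coe_smul, smul_eq_mul,
            RingHom.id_apply]
          rw [integral_const_mul, integral_const_mul]
          ring }
      ((z t).toJordanDecomposition.posPart.real univ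
        + (z t).toJordanDecomposition.negPart.real univ) fun φ => by
        have h1 := φ.norm_integral_le_mul_norm (z t).toJordanDecomposition.posPart
        have h2 := φ.norm_integral_le_mul_norm (z t).toJordanDecomposition.negPart
        rw [add_mul]
        exact (norm_sub_le _ _).trans (add_le_add h1 h2)
  obtain ⟨C, hC⟩ := banach_steinhaus (g := L) hz
  exact ⟨C, (norm_nonneg _).trans (hC 0), fun t φ =>
    ((L t).le_opNorm φ).trans (mul_le_mul_of_nonneg_right (hC t) (norm_nonneg _))⟩

theorem posPart_univ_le {μ : SignedMeasure ℝ} {C : ℝ} (hC : 0 ≤ C)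
    (h : ∀ φ : ℝ →ᵇ ℝ, |sintegral μ φ| ≤ C * ‖φ‖) :
    μ.toJordanDecomposition.posPart univ ≤ ENNReal.ofReal C := by
  refine le_of_not_gt fun hlt => ?_
  obtain ⟨f, hf, -, hCf⟩ := (ofReal_lt_posPart_apply_iff isOpen_univ hC).1 hlt
  have hf1 : ‖f‖ ≤ 1 := (BoundedContinuousFunction.norm_le zero_le_one).2 fun x => by
    rw [Real.norm_of_nonneg (hf x).1]; exact (hf x).2
  have := (le_abs_self _).trans (h f)
  nlinarith

theorem exists_kernel_jordan {z : ℝ → SignedMeasure ℝ}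
    (hz : ∀ φ : ℝ →ᵇ ℝ, Continuous fun t => sintegral (z t) φ) {C : ℝ} (hC : 0 ≤ C)
    (hb : ∀ t, ∀ φ : ℝ →ᵇ ℝ, |sintegral (z t) φ| ≤ C * ‖φ‖) :
    ∃ P N : Kernel ℝ ℝ, IsFiniteKernel P ∧ IsFiniteKernel N ∧
      (∀ t, P t = (z t).toJordanDecomposition.posPart) ∧
      ∀ t, N t = (z t).toJordanDecomposition.negPart := by
  have hneg : ∀ t, (z t).toJordanDecomposition.negPart = (-z t).toJordanDecomposition.posPart :=
    fun t => by rw [SignedMeasure.toJordanDecomposition_neg, JordanDecomposition.neg_posPart]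
  refine ⟨⟨_, measurable_jordan_posPart hz⟩, ⟨fun t => (-z t).toJordanDecomposition.posPart,
    measurable_jordan_posPart fun φ => by simp only [sintegral_neg]; exact (hz φ).neg⟩,
    ⟨ENNReal.ofReal C, ENNReal.ofReal_lt_top, fun t => posPart_univ_le hC (hb t)⟩,
    ⟨ENNReal.ofReal C, ENNReal.ofReal_lt_top, fun t => posPart_univ_le hC fun φ => by
      rw [sintegral_neg, abs_neg]; exact hb t φ⟩, fun t => rfl, fun t => (hneg t).symm⟩

theorem signedMeasure_apply_eq {α : Type*} [MeasurableSpace α] (μ : SignedMeasure α) {A : Set α}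
    (hA : MeasurableSet A) : μ A = μ.toJordanDecomposition.posPart.real A
      - μ.toJordanDecomposition.negPart.real A := by
  conv_lhs => rw [← μ.toSignedMeasure_toJordanDecomposition, JordanDecomposition.toSignedMeasure]
  rw [sub_apply, Measure.toSignedMeasure_apply_measurable hA,
    Measure.toSignedMeasure_apply_measurable hA]

open Filter in
theorem integrable_of_signedMeasure_apply_eq {μ : SignedMeasure ℝ} {h : ℝ → ℝ}
    (hh : Measurable h) (hloc : ∀ n : ℕ, IntegrableOn h (Icc (-n) n))
    (hμ : ∀ A : Set ℝ, MeasurableSet A → μ A = ∫ x in A, h x) : Integrable h := by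
  set P := μ.toJordanDecomposition.posPart
  set N := μ.toJordanDecomposition.negPart
  have hb : ∀ A, MeasurableSet A → |∫ x in A, h x| ≤ P.real univ + N.real univ := by
    intro A hA
    rw [← hμ A hA, signedMeasure_apply_eq μ hA]
    have h1 : P.real A ≤ P.real univ := measureReal_mono (subset_univ _)
    have h2 : N.real A ≤ N.real univ := measureReal_mono (subset_univ _)
    have h3 : 0 ≤ P.real A := measureReal_nonneg
    have h4 : 0 ≤ N.real A := measureReal_nonneg
    exact abs_sub_le_iff.2 ⟨by linarith, by linarith⟩
  have hc : AECover volume atTop fun n : ℕ => Icc (-(n:ℝ)) n :=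
    aecover_Icc (tendsto_neg_atTop_atBot.comp tendsto_natCast_atTop_atTop)
      tendsto_natCast_atTop_atTop
  refine hc.integrable_of_integral_norm_bounded (2 * (P.real univ + N.real univ)) hloc
    (.of_forall fun n => ?_)
  have hp : MeasurableSet {x | 0 ≤ h x} := measurableSet_le measurable_const hh
  rw [← integral_add_compl hp (hloc n).norm, Measure.restrict_restrict hp,
    Measure.restrict_restrict hp.compl]
  have e1 : ∫ x in {x | 0 ≤ h x} ∩ Icc (-(n:ℝ)) n, ‖h x‖
      = ∫ x in {x | 0 ≤ h x} ∩ Icc (-(n:ℝ)) n, h x :=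
    setIntegral_congr_fun (hp.inter measurableSet_Icc) fun x hx => Real.norm_of_nonneg hx.1
  have e2 : ∫ x in {x | 0 ≤ h x}ᶜ ∩ Icc (-(n:ℝ)) n, ‖h x‖
      = -∫ x in {x | 0 ≤ h x}ᶜ ∩ Icc (-(n:ℝ)) n, h x := by
    rw [← integral_neg]
    exact setIntegral_congr_fun (hp.compl.inter measurableSet_Icc) fun x hx =>
      Real.norm_of_nonpos (not_le.1 (show ¬ 0 ≤ h x from hx.1)).le
  rw [e1, e2]
  have h1 := (le_abs_self _).trans (hb _ (hp.inter (measurableSet_Icc (a := -(n:ℝ)) (b := n))))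
  have h2 := (neg_le_abs _).trans
    (hb _ (hp.compl.inter (measurableSet_Icc (a := -(n:ℝ)) (b := n))))
  linarith

theorem le_add_of_mutuallySingular {α : Type*} [MeasurableSpace α] {P₁ N₁ P₂ N₂ αp αm : Measure α}
    (h₁ : P₁ ⟂ₘ N₁) (H : P₁ + N₂ + αm = P₂ + N₁ + αp) : P₁ ≤ P₂ + αp := by
  obtain ⟨S, hS, hP, hN⟩ := h₁
  refine Measure.le_iff.2 fun A hA => ?_
  have hNA : N₁ (A ∩ Sᶜ) = 0 := measure_mono_null inter_subset_right hN
  calc P₁ A = P₁ (A ∩ Sᶜ) := (measure_inter_conull (by simpa using hP)).symm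
    _ ≤ (P₁ + N₂ + αm) (A ∩ Sᶜ) := by
      rw [add_assoc, Measure.add_apply]; exact le_self_add
    _ = (P₂ + αp) (A ∩ Sᶜ) := by
      rw [H]; simp [Measure.add_apply, hNA]
    _ ≤ (P₂ + αp) A := measure_mono inter_subset_left

theorem exists_measure_add_eq {α : Type*} [MeasurableSpace α] {P₁ N₁ P₂ N₂ αp αm : Measure α}
    [IsFiniteMeasure P₁] [IsFiniteMeasure P₂] [IsFiniteMeasure αp] [IsFiniteMeasure αm]
    (h₁ : P₁ ⟂ₘ N₁) (h₂ : P₂ ⟂ₘ N₂) (H : P₁ + N₂ + αm = P₂ + N₁ + αp) :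
    ∃ ρ : Measure α, ρ ≤ αp + αm ∧ P₁ + αm = P₂ + ρ ∧ N₁ + αp = N₂ + ρ := by
  have hle1 : P₁ ≤ P₂ + αp := le_add_of_mutuallySingular h₁ H
  have hle2 : P₂ ≤ P₁ + αm := le_add_of_mutuallySingular h₂ H.symm
  obtain ⟨ρ, hρ, hρle⟩ : ∃ ρ : Measure α, ρ + P₂ = P₁ + αm ∧ ρ ≤ αp + αm := by
    refine ⟨P₁ + αm - P₂, Measure.sub_add_cancel_of_le hle2, ?_⟩
    rw [Measure.sub_le_iff_le_add_of_le hle2]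
    calc P₁ + αm ≤ P₂ + αp + αm := by gcongr
      _ = αp + αm + P₂ := by abel
  refine ⟨ρ, hρle, by rw [← hρ, add_comm], ?_⟩
  have e : P₂ + (N₁ + αp) = P₂ + (N₂ + ρ) := by
    calc P₂ + (N₁ + αp) = P₁ + αm + N₂ := by rw [← add_assoc, ← H]; abel
      _ = P₂ + (N₂ + ρ) := by rw [← hρ]; abel
  ext A hA
  have := congrArg (fun m : Measure α => m A) e
  simp only [Measure.add_apply] at this ⊢
  exact (ENNReal.add_right_inj (measure_ne_top P₂ A)).1 this

/-- The measure on `ℝ` whose density with respect to Lebesgue measure is the positive part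
of `u`. -/
noncomputable def densityMeasure (u : ℝ → ℝ) : Measure ℝ :=
  volume.withDensity fun x => ENNReal.ofReal (u x)

theorem isFiniteMeasure_densityMeasure {u : ℝ → ℝ} (hu : Integrable u) :
    IsFiniteMeasure (densityMeasure u) :=
  isFiniteMeasure_withDensity_ofReal hu.2

theorem densityMeasure_add_neg {u : ℝ → ℝ} (hu : Measurable u) :
    densityMeasure u + densityMeasure (fun x => -u x) = densityMeasure fun x => |u x| := by
  rw [densityMeasure, densityMeasure, ← withDensity_add_left hu.ennreal_ofReal, densityMeasure]
  congr 1
  ext x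
  rcases le_total 0 (u x) with h | h
  · simp [abs_of_nonneg h, ENNReal.ofReal_of_nonpos (neg_nonpos.2 h)]
  · simp [abs_of_nonpos h, ENNReal.ofReal_of_nonpos h]

theorem measureReal_densityMeasure_sub {u : ℝ → ℝ} (hu : Integrable u) {A : Set ℝ}
    (hA : MeasurableSet A) :
    (densityMeasure u).real A - (densityMeasure fun x => -u x).real A = ∫ x in A, u x := by
  rw [integral_eq_lintegral_pos_part_sub_lintegral_neg_part hu.integrableOn, measureReal_def,
    measureReal_def, densityMeasure, densityMeasure, withDensity_apply _ hA,
    withDensity_apply _ hA]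

theorem jordan_add_eq_of_sub_eq_density {μ₁ μ₂ : SignedMeasure ℝ} {u : ℝ → ℝ}
    (hu : Integrable u)
    (h : ∀ A : Set ℝ, MeasurableSet A → (μ₁ - μ₂) A = ∫ x in A, u x) :
    μ₁.toJordanDecomposition.posPart + μ₂.toJordanDecomposition.negPart
        + densityMeasure (fun x => -u x)
      = μ₂.toJordanDecomposition.posPart + μ₁.toJordanDecomposition.negPart
        + densityMeasure u := by
  have := isFiniteMeasure_densityMeasure hu
  have := isFiniteMeasure_densityMeasure hu.neg
  change IsFiniteMeasure (densityMeasure fun x => -u x) at this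
  ext A hA
  rw [← measureReal_eq_measureReal_iff]
  have e := h A hA
  rw [sub_apply, signedMeasure_apply_eq μ₁ hA, signedMeasure_apply_eq μ₂ hA,
    ← measureReal_densityMeasure_sub hu hA] at e
  rw [measureReal_add_apply, measureReal_add_apply, measureReal_add_apply, measureReal_add_apply]
  linarith

theorem exists_densities {μ₁ μ₂ : SignedMeasure ℝ} {u : ℝ → ℝ}
    (hum : Measurable u) (hu : Integrable u)
    (h : ∀ A : Set ℝ, MeasurableSet A → (μ₁ - μ₂) A = ∫ x in A, u x) :
    ∃ r : ℝ → ℝ, Measurable r ∧ (∀ x, 0 ≤ r x) ∧ (∀ᵐ x, r x ≤ |u x|) ∧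
      μ₁.toJordanDecomposition.posPart + densityMeasure (fun x => -u x)
        = μ₂.toJordanDecomposition.posPart + densityMeasure r ∧
      μ₁.toJordanDecomposition.negPart + densityMeasure u
        = μ₂.toJordanDecomposition.negPart + densityMeasure r := by
  have := isFiniteMeasure_densityMeasure hu
  have := isFiniteMeasure_densityMeasure hu.neg
  change IsFiniteMeasure (densityMeasure fun x => -u x) at this
  obtain ⟨ρ, hρ, e1, e2⟩ := exists_measure_add_eq μ₁.toJordanDecomposition.mutuallySingular
    μ₂.toJordanDecomposition.mutuallySingular (jordan_add_eq_of_sub_eq_density hu h)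
  rw [densityMeasure_add_neg hum] at hρ
  have := isFiniteMeasure_densityMeasure hu.abs
  change IsFiniteMeasure (densityMeasure fun x => |u x|) at this
  have hρf : IsFiniteMeasure ρ := isFiniteMeasure_of_le _ hρ
  have hac : ρ ≪ volume :=
    (Measure.absolutelyContinuous_of_le hρ).trans (withDensity_absolutelyContinuous _ _)
  have hρr : ρ = densityMeasure fun x => (ρ.rnDeriv volume x).toReal := by
    conv_lhs => rw [← Measure.withDensity_rnDeriv_eq ρ volume hac]
    refine withDensity_congr_ae ?_
    filter_upwards [ρ.rnDeriv_ne_top volume] with x hx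
    rw [ENNReal.ofReal_toReal hx]
  refine ⟨fun x => (ρ.rnDeriv volume x).toReal, (Measure.measurable_rnDeriv _ _).ennreal_toReal,
    fun x => ENNReal.toReal_nonneg, ?_, by rw [← hρr]; exact e1, by rw [← hρr]; exact e2⟩
  have : ρ.rnDeriv volume ≤ᵐ[volume] fun x => ENNReal.ofReal |u x| := by
    refine ae_le_of_forall_setLIntegral_le_of_sigmaFinite (Measure.measurable_rnDeriv _ _)
      fun A hA _ => ?_
    rw [← withDensity_apply _ hA, ← withDensity_apply _ hA,
      Measure.withDensity_rnDeriv_eq ρ volume hac]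
    exact hρ A
  filter_upwards [this] with x hx
  exact ENNReal.toReal_le_of_le_ofReal (abs_nonneg _) hx

theorem densityMeasure_max (u : ℝ → ℝ) :
    densityMeasure (fun x => max (u x) 0) = densityMeasure u := by
  simp [densityMeasure, ENNReal.ofReal_max]

theorem integrable_densityMeasure_iff {u f : ℝ → ℝ} (hu : Measurable u) (h0 : ∀ x, 0 ≤ u x) :
    Integrable f (densityMeasure u) ↔ Integrable fun x => f x * u x := by
  rw [densityMeasure, integrable_withDensity_iff_integrable_smul' hu.ennreal_ofReal
    (.of_forall fun _ => ENNReal.ofReal_lt_top)]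
  simp only [ENNReal.toReal_ofReal (h0 _), smul_eq_mul, mul_comm]

theorem integral_densityMeasure {u f : ℝ → ℝ} (hu : Measurable u) (h0 : ∀ x, 0 ≤ u x) :
    ∫ x, f x ∂densityMeasure u = ∫ x, f x * u x := by
  rw [densityMeasure, integral_withDensity_eq_integral_toReal_smul hu.ennreal_ofReal
    (.of_forall fun _ => ENNReal.ofReal_lt_top)]
  simp only [ENNReal.toReal_ofReal (h0 _), smul_eq_mul, mul_comm]

theorem integral_sub_integral_of_add_densityMeasure_eq {Q₁ Q₂ : Measure ℝ} {u v f : ℝ → ℝ}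
    (hu : Measurable u) (hv : Measurable v) (hu0 : ∀ x, 0 ≤ u x) (hv0 : ∀ x, 0 ≤ v x)
    (hQ : Q₁ + densityMeasure u = Q₂ + densityMeasure v)
    (hfu : Integrable fun x => f x * u x) (hfv : Integrable fun x => f x * v x) :
    (Integrable f Q₁ ↔ Integrable f Q₂) ∧ (Integrable f Q₁ →
      (∫ x, f x ∂Q₁) - ∫ x, f x ∂Q₂ = ∫ x, f x * (v x - u x)) := by
  have hfu' := (integrable_densityMeasure_iff hu hu0).2 hfu
  have hfv' := (integrable_densityMeasure_iff hv hv0).2 hfv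
  have hiff : Integrable f Q₁ ↔ Integrable f Q₂ := by
    have h1 : Integrable f (Q₁ + densityMeasure u) ↔ _ := integrable_add_measure
    have h2 : Integrable f (Q₂ + densityMeasure v) ↔ _ := integrable_add_measure
    rw [hQ, h2] at h1
    tauto
  refine ⟨hiff, fun h1 => ?_⟩
  have e : ∫ x, f x ∂(Q₁ + densityMeasure u) = ∫ x, f x ∂(Q₂ + densityMeasure v) := by rw [hQ]
  rw [integral_add_measure h1 hfu', integral_add_measure (hiff.1 h1) hfv',
    integral_densityMeasure hu hu0, integral_densityMeasure hv hv0] at e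
  simp only [mul_sub]
  rw [integral_sub hfv hfu]
  linarith

/-- A jointly measurable version of the Lebesgue density of `P₁ s - P₂ s`, when this difference
is absolutely continuous. -/
noncomputable def kernelDensity (P₁ P₂ : Kernel ℝ ℝ) (s x : ℝ) : ℝ :=
  ((P₁.rnDeriv (Kernel.const ℝ (gaussianReal 0 1)) s x).toReal
    - (P₂.rnDeriv (Kernel.const ℝ (gaussianReal 0 1)) s x).toReal) * gaussianPDFReal 0 1 x

theorem measurable_kernelDensity (P₁ P₂ : Kernel ℝ ℝ) :
    Measurable (Function.uncurry (kernelDensity P₁ P₂)) :=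
  ((Kernel.measurable_rnDeriv P₁ _).ennreal_toReal.sub
    (Kernel.measurable_rnDeriv P₂ _).ennreal_toReal).mul
    ((measurable_gaussianPDFReal 0 1).comp measurable_snd)

theorem rnDeriv_densityMeasure_gaussianReal {u : ℝ → ℝ} (hu : Measurable u) :
    (densityMeasure u).rnDeriv (gaussianReal 0 1) =ᵐ[gaussianReal 0 1]
      fun x => (gaussianPDF 0 1 x)⁻¹ * ENNReal.ofReal (u x) := by
  have hG := measurable_gaussianPDF 0 1
  have hGi : Measurable fun x => (gaussianPDF 0 1 x)⁻¹ := hG.inv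
  have hvol : (gaussianReal 0 1).withDensity (fun x => (gaussianPDF 0 1 x)⁻¹) = volume := by
    rw [gaussianReal_of_var_ne_zero 0 one_ne_zero]
    exact withDensity_inv_same₀ hG.aemeasurable
      (.of_forall fun x => (gaussianPDF_pos 0 one_ne_zero x).ne')
      (.of_forall fun x => gaussianPDF_ne_top)
  have : densityMeasure u = (gaussianReal 0 1).withDensity
      ((fun x => (gaussianPDF 0 1 x)⁻¹) * fun x => ENNReal.ofReal (u x)) := by
    rw [withDensity_mul _ hGi hu.ennreal_ofReal, hvol, densityMeasure]
  rw [this]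
  exact Measure.rnDeriv_withDensity _ (hGi.mul hu.ennreal_ofReal)

theorem kernelDensity_ae_eq {P₁ P₂ : Kernel ℝ ℝ} [IsFiniteKernel P₁] [IsFiniteKernel P₂] {s : ℝ}
    {u v : ℝ → ℝ} (hu : Measurable u) (hv : Measurable v) (hu0 : ∀ x, 0 ≤ u x)
    (hv0 : ∀ x, 0 ≤ v x) (hui : Integrable u) (hvi : Integrable v)
    (h : P₁ s + densityMeasure u = P₂ s + densityMeasure v) :
    ∀ᵐ x, kernelDensity P₁ P₂ s x = v x - u x := by
  have := isFiniteMeasure_densityMeasure hui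
  have := isFiniteMeasure_densityMeasure hvi
  set γ : Measure ℝ := gaussianReal 0 1
  refine (gaussianReal_absolutelyContinuous' 0 one_ne_zero).ae_le ?_
  have e1 := Measure.rnDeriv_add (P₁ s) (densityMeasure u) γ
  have e2 := Measure.rnDeriv_add (P₂ s) (densityMeasure v) γ
  have k1 : P₁.rnDeriv (Kernel.const ℝ γ) s =ᵐ[γ] (P₁ s).rnDeriv γ := by
    have := Kernel.rnDeriv_eq_rnDeriv_measure (κ := P₁) (η := Kernel.const ℝ γ) (a := s)
    rwa [Kernel.const_apply] at this
  have k2 : P₂.rnDeriv (Kernel.const ℝ γ) s =ᵐ[γ] (P₂ s).rnDeriv γ := by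
    have := Kernel.rnDeriv_eq_rnDeriv_measure (κ := P₂) (η := Kernel.const ℝ γ) (a := s)
    rwa [Kernel.const_apply] at this
  rw [h] at e1
  filter_upwards [e1, e2, k1, k2, rnDeriv_densityMeasure_gaussianReal hu,
    rnDeriv_densityMeasure_gaussianReal hv, (P₁ s).rnDeriv_ne_top γ, (P₂ s).rnDeriv_ne_top γ]
    with x e1 e2 k1 k2 du dv f1 f2
  rw [e1, Pi.add_apply, Pi.add_apply, du, dv] at e2
  have hG : gaussianPDFReal 0 1 x ≠ 0 := (gaussianPDFReal_pos 0 1 x one_ne_zero).ne'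
  have hGt : (gaussianPDF 0 1 x)⁻¹ ≠ ⊤ :=
    ENNReal.inv_ne_top.2 (gaussianPDF_pos 0 one_ne_zero x).ne'
  have e3 := congrArg ENNReal.toReal e2
  rw [ENNReal.toReal_add f1 (ENNReal.mul_ne_top hGt ENNReal.ofReal_ne_top),
    ENNReal.toReal_add f2 (ENNReal.mul_ne_top hGt ENNReal.ofReal_ne_top), ENNReal.toReal_mul,
    ENNReal.toReal_mul, ENNReal.toReal_inv, ENNReal.toReal_ofReal (hu0 x),
    ENNReal.toReal_ofReal (hv0 x), toReal_gaussianPDF] at e3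
  change ((P₁.rnDeriv (Kernel.const ℝ γ) s x).toReal
    - (P₂.rnDeriv (Kernel.const ℝ γ) s x).toReal) * gaussianPDFReal 0 1 x = _
  rw [k1, k2]
  field_simp at e3
  linarith

theorem kernelDensity_properties {P₁ P₂ N₁ N₂ : Kernel ℝ ℝ} [IsFiniteKernel P₁]
    [IsFiniteKernel P₂] [IsFiniteKernel N₁] [IsFiniteKernel N₂] {μ₁ μ₂ : SignedMeasure ℝ} {s : ℝ}
    (hP₁ : P₁ s = μ₁.toJordanDecomposition.posPart)
    (hN₁ : N₁ s = μ₁.toJordanDecomposition.negPart)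
    (hP₂ : P₂ s = μ₂.toJordanDecomposition.posPart)
    (hN₂ : N₂ s = μ₂.toJordanDecomposition.negPart) {u : ℝ → ℝ}
    (hum : Measurable u) (hu : Integrable u)
    (h : ∀ A : Set ℝ, MeasurableSet A → (μ₁ - μ₂) A = ∫ x in A, u x) :
    (∀ᵐ x, |kernelDensity P₁ P₂ s x| ≤ |u x| ∧ 0 ≤ kernelDensity P₁ P₂ s x * u x ∧
      kernelDensity N₁ N₂ s x = kernelDensity P₁ P₂ s x - u x ∧ |kernelDensity N₁ N₂ s x| ≤ |u x|
      ∧ kernelDensity N₁ N₂ s x * u x ≤ 0) ∧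
    ∀ f : ℝ → ℝ, Measurable f → Integrable (fun x => f x * u x) →
      ((Integrable f (P₁ s) ↔ Integrable f (P₂ s)) ∧ (Integrable f (P₁ s) →
        (∫ x, f x ∂P₁ s) - ∫ x, f x ∂P₂ s = ∫ x, f x * kernelDensity P₁ P₂ s x)) ∧
      ((Integrable f (N₁ s) ↔ Integrable f (N₂ s)) ∧ (Integrable f (N₁ s) →
        (∫ x, f x ∂N₁ s) - ∫ x, f x ∂N₂ s = ∫ x, f x * kernelDensity N₁ N₂ s x)) := by
  obtain ⟨r, hr, hr0, hru, e1, e2⟩ := exists_densities hum hu h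
  rw [← hP₁, ← hP₂, ← densityMeasure_max] at e1
  rw [← hN₁, ← hN₂, ← densityMeasure_max] at e2
  have hum' := hum.neg.max (measurable_const (a := (0:ℝ)))
  have hup := hum.max (measurable_const (a := (0:ℝ)))
  have hri : Integrable r := hu.abs.mono' hr.aestronglyMeasurable (by
    filter_upwards [hru] with x hx
    rwa [Real.norm_of_nonneg (hr0 x)])
  have k1 := kernelDensity_ae_eq (u := fun x => max (-u x) 0) hum' hr (fun x => le_max_right _ _)
    hr0 hu.neg.pos_part hri e1
  have k2 := kernelDensity_ae_eq (u := fun x => max (u x) 0) hup hr (fun x => le_max_right _ _)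
    hr0 hu.pos_part hri e2
  refine ⟨?_, fun f hf hfu => ?_⟩
  · filter_upwards [k1, k2, hru] with x k1 k2 hx
    have := hr0 x
    rw [k1, k2]
    rcases le_total 0 (u x) with h0 | h0
    · rw [abs_of_nonneg h0] at hx ⊢
      rw [max_eq_left h0, max_eq_right (neg_nonpos.2 h0)]
      refine ⟨abs_le.2 ⟨?_, ?_⟩, ?_, ?_, abs_le.2 ⟨?_, ?_⟩, ?_⟩ <;> nlinarith
    · rw [abs_of_nonpos h0] at hx ⊢
      rw [max_eq_right h0, max_eq_left (neg_nonneg.2 h0)]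
      refine ⟨abs_le.2 ⟨?_, ?_⟩, ?_, ?_, abs_le.2 ⟨?_, ?_⟩, ?_⟩ <;> nlinarith
  · have hdom : ∀ w : ℝ → ℝ, Measurable w → (∀ᵐ x, |w x| ≤ |u x|) →
        Integrable fun x => f x * w x := fun w hw hwu =>
      hfu.mono (hf.mul hw).aestronglyMeasurable (by
        filter_upwards [hwu] with x hx
        rw [norm_mul, norm_mul]
        exact mul_le_mul_of_nonneg_left hx (norm_nonneg _))
    have hfr := hdom r hr (by filter_upwards [hru] with x hx; rwa [abs_of_nonneg (hr0 x)])
    have hfm := hdom _ hum' (.of_forall fun x => by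
      rw [abs_of_nonneg (le_max_right _ _)]
      exact max_le (neg_le_abs _) (abs_nonneg _))
    have hfp := hdom _ hup (.of_forall fun x => by
      rw [abs_of_nonneg (le_max_right _ _)]
      exact max_le (le_abs_self _) (abs_nonneg _))
    obtain ⟨i1, j1⟩ := integral_sub_integral_of_add_densityMeasure_eq hum' hr
      (fun x => le_max_right _ _) hr0 e1 hfm hfr
    obtain ⟨i2, j2⟩ := integral_sub_integral_of_add_densityMeasure_eq hup hr
      (fun x => le_max_right _ _) hr0 e2 hfp hfr
    refine ⟨⟨i1, fun hi => (j1 hi).trans (integral_congr_ae ?_)⟩,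
      ⟨i2, fun hi => (j2 hi).trans (integral_congr_ae ?_)⟩⟩
    · filter_upwards [k1] with x hx
      exact congrArg (f x * ·) hx.symm
    · filter_upwards [k2] with x hx
      exact congrArg (f x * ·) hx.symm

open Polynomial in
theorem exists_bound_pow_mul_aeval_mul_gaussian (p : ℤ[X]) (k : ℕ) :
    ∃ C : ℝ, ∀ x : ℝ, |x| ^ k * |aeval x p * Real.exp (-(x ^ 2 / 2))| ≤ C := by
  have hmono : ∀ m : ℕ, ∀ x : ℝ, |x| ^ m * Real.exp (-(x ^ 2 / 2)) ≤ 1 + 2 ^ m * m.factorial := by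
    intro m x
    have h1 := Real.pow_div_factorial_le_exp (x := x ^ 2 / 2) (by positivity) m
    rw [div_le_iff₀ (by positivity)] at h1
    have h2 : |x| ^ m ≤ 1 + (x ^ 2) ^ m := by
      rw [← sq_abs, ← pow_mul, mul_comm 2 m, pow_mul]
      nlinarith [sq_nonneg (|x| ^ m - 1), pow_nonneg (abs_nonneg x) m]
    have h3 : (x ^ 2) ^ m = 2 ^ m * (x ^ 2 / 2) ^ m := by
      rw [← mul_pow]; congr 1; ring
    have h4 : 1 ≤ Real.exp (x ^ 2 / 2) := Real.one_le_exp (by positivity)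
    rw [Real.exp_neg, ← div_eq_mul_inv, div_le_iff₀ (Real.exp_pos _)]
    calc |x| ^ m ≤ 1 + 2 ^ m * (x ^ 2 / 2) ^ m := by rw [← h3]; exact h2
      _ ≤ Real.exp (x ^ 2 / 2) + 2 ^ m * (Real.exp (x ^ 2 / 2) * m.factorial) := by gcongr
      _ = _ := by ring
  induction p using Polynomial.induction_on' with
  | add p q hp hq =>
    obtain ⟨C, hC⟩ := hp
    obtain ⟨C', hC'⟩ := hq
    refine ⟨C + C', fun x => le_trans ?_ (add_le_add (hC x) (hC' x))⟩
    rw [map_add, add_mul, ← mul_add]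
    gcongr
    exact abs_add_le _ _
  | monomial n c =>
    refine ⟨|(c : ℝ)| * (1 + 2 ^ (k + n) * (k + n).factorial), fun x => ?_⟩
    rw [aeval_monomial, abs_mul, abs_mul, abs_pow, abs_of_pos (Real.exp_pos _)]
    calc |x| ^ k * (|(algebraMap ℤ ℝ) c| * |x| ^ n * Real.exp (-(x ^ 2 / 2)))
        = |(c : ℝ)| * (|x| ^ (k + n) * Real.exp (-(x ^ 2 / 2))) := by
          rw [pow_add]; simp only [algebraMap_int_eq, eq_intCast]; ring
      _ ≤ _ := by gcongr; exact hmono _ x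

/-- The standard Gaussian `x ↦ exp (-x² / 2)` as a Schwartz function. -/
noncomputable def gaussianSchwartz : SchwartzMap ℝ ℝ where
  toFun x := Real.exp (-(x ^ 2 / 2))
  smooth' := by fun_prop
  decay' k n := by
    obtain ⟨C, hC⟩ := exists_bound_pow_mul_aeval_mul_gaussian (Polynomial.hermite n) k
    refine ⟨C, fun x => ?_⟩
    rw [norm_iteratedFDeriv_eq_norm_iteratedDeriv, iteratedDeriv_eq_iterate,
      Polynomial.deriv_gaussian_eq_hermite_mul_gaussian, mul_assoc, norm_mul, norm_pow, norm_neg,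
      norm_one, one_pow, one_mul]
    exact hC x

/-- The second derivative of a Schwartz function. -/
noncomputable def secondDeriv : SchwartzMap ℝ ℝ →L[ℝ] SchwartzMap ℝ ℝ :=
  (SchwartzMap.derivCLM ℝ ℝ).comp (SchwartzMap.derivCLM ℝ ℝ)

theorem secondDeriv_apply (φ : SchwartzMap ℝ ℝ) (x : ℝ) :
    secondDeriv φ x = deriv (deriv φ) x := rfl

theorem exists_secondDeriv_abs_add_pos :
    ∃ ψ₁ ψ₂ : SchwartzMap ℝ ℝ, ∀ x, 0 < |secondDeriv ψ₁ x| + |secondDeriv ψ₂ x| := by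
  refine ⟨gaussianSchwartz, SchwartzMap.derivCLM ℝ ℝ gaussianSchwartz, fun x => ?_⟩
  have e2 : secondDeriv gaussianSchwartz x = (x ^ 2 - 1) * Real.exp (-(x ^ 2 / 2)) := by
    change deriv^[2] (fun y => Real.exp (-(y ^ 2 / 2))) x = _
    rw [Polynomial.deriv_gaussian_eq_hermite_mul_gaussian]
    simp [Polynomial.hermite_succ]
    ring
  have e3 : secondDeriv (SchwartzMap.derivCLM ℝ ℝ gaussianSchwartz) x
      = -(x ^ 3 - 3 * x) * Real.exp (-(x ^ 2 / 2)) := by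
    change deriv^[3] (fun y => Real.exp (-(y ^ 2 / 2))) x = _
    rw [Polynomial.deriv_gaussian_eq_hermite_mul_gaussian]
    simp [Polynomial.hermite_succ]
    ring
  rw [e2, e3, abs_mul, abs_mul, ← add_mul]
  refine mul_pos ?_ (abs_pos.2 (Real.exp_pos _).ne')
  by_contra h
  have h1 : x ^ 2 - 1 = 0 := abs_eq_zero.1 (by
    linarith [abs_nonneg (x ^ 2 - 1), abs_nonneg (-(x ^ 3 - 3 * x))])
  have h2 : -(x ^ 3 - 3 * x) = 0 := abs_eq_zero.1 (by
    linarith [abs_nonneg (x ^ 2 - 1), abs_nonneg (-(x ^ 3 - 3 * x))])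
  have h3 : 2 * x = 0 := by linear_combination h2 + x * h1
  have h4 : x = 0 := by linarith
  norm_num [h4] at h1

theorem exists_abs_secondDeriv_le {ψ₁ ψ₂ φ : SchwartzMap ℝ ℝ}
    (hψ : ∀ x, 0 < |secondDeriv ψ₁ x| + |secondDeriv ψ₂ x|) (hφ : HasCompactSupport φ) :
    ∃ C, ∀ x, |secondDeriv φ x| ≤ C * (|secondDeriv ψ₁ x| + |secondDeriv ψ₂ x|) := by
  have hs : HasCompactSupport (secondDeriv φ) := hφ.deriv.deriv
  have hc : Continuous fun x => |secondDeriv φ x| / (|secondDeriv ψ₁ x| + |secondDeriv ψ₂ x|) :=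
    (secondDeriv φ).continuous.abs.div₀
      ((secondDeriv ψ₁).continuous.abs.add (secondDeriv ψ₂).continuous.abs) fun x => (hψ x).ne'
  obtain ⟨C, hC⟩ := hs.exists_bound_of_continuousOn hc.continuousOn
  refine ⟨max C 0, fun x => ?_⟩
  by_cases hx : x ∈ tsupport (secondDeriv φ)
  · have := (le_abs_self _).trans ((hC x hx).trans (le_max_left C 0))
    rwa [div_le_iff₀ (hψ x)] at this
  · rw [image_eq_zero_of_notMem_tsupport hx, abs_zero]
    exact mul_nonneg (le_max_right _ _) (hψ x).le

theorem ae_integrable_of_integrable_add_smul {m : Measure ℝ} [IsFiniteMeasure m] (Q : Kernel ℝ ℝ)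
    [IsFiniteKernel Q] {a : ℝ → ℝ → ℝ} (ha : Measurable (Function.uncurry a)) {b c : ℝ → ℝ}
    (hb : Measurable b) (hc : Measurable c) :
    ∃ S : Set ℝ, S.Countable ∧ ∀ l ∉ S, ∀ᵐ s ∂m,
      Integrable (fun x => (b x + l * c x) * a s x) (Q s) →
        Integrable (fun x => c x * a s x) (Q s) := by
  have hms : ∀ d : ℝ → ℝ, Measurable d →
      MeasurableSet {s | Integrable (fun x => d x * a s x) (Q s)} := fun d hd =>
    measurableSet_kernel_integrable (f := fun s x => d x * a s x)
      ((hd.comp measurable_snd).mul ha).stronglyMeasurable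
  set As : ℝ → Set ℝ := fun l => {s | Integrable (fun x => (b x + l * c x) * a s x) (Q s)} \
    {s | Integrable (fun x => c x * a s x) (Q s)} with hAs
  have hmeas : ∀ l, MeasurableSet (As l) := fun l =>
    (hms _ (hb.add (hc.const_mul l))).diff (hms _ hc)
  have hdisj : Pairwise (Function.onFun Disjoint As) := by
    intro l l' hne
    refine Set.disjoint_left.2 fun s hs hs' => hs.2 ?_
    refine (((hs.1 : Integrable _ _).sub (hs'.1 : Integrable _ _)).const_mul (l - l')⁻¹).congr
      (Filter.Eventually.of_forall fun x => ?_)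
    have : l - l' ≠ 0 := sub_ne_zero.2 hne
    simp only [Pi.sub_apply]
    field_simp
    ring
  refine ⟨{l | 0 < m (As l)}, Measure.countable_meas_pos_of_disjoint_iUnion hmeas hdisj, ?_⟩
  intro l hl
  have h0 : m (As l) = 0 := by simpa using hl
  filter_upwards [measure_eq_zero_iff_ae_notMem.1 h0] with s hs h
  by_contra h'
  exact hs ⟨h, h'⟩

/-- The set of times at which the weighted coefficient `c * a` is integrable for the kernel. -/
def integrabilitySet (Q : Kernel ℝ ℝ) (a : ℝ → ℝ → ℝ) (c : ℝ → ℝ) : Set ℝ :=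
  {s | Integrable (fun x => c x * a s x) (Q s)}

theorem measurableSet_integrabilitySet (Q : Kernel ℝ ℝ) [IsFiniteKernel Q] {a : ℝ → ℝ → ℝ}
    (ha : Measurable (Function.uncurry a)) {c : ℝ → ℝ} (hc : Measurable c) :
    MeasurableSet (integrabilitySet Q a c) :=
  measurableSet_kernel_integrable (f := fun s x => c x * a s x)
    ((hc.comp measurable_snd).mul ha).stronglyMeasurable

theorem ae_integral_sub_integral_eq_indicator {m : Measure ℝ} [IsFiniteMeasure m]
    {Q₁ Q₂ : Kernel ℝ ℝ} [IsFiniteKernel Q₁] {a g k : ℝ → ℝ → ℝ}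
    (ha : Measurable (Function.uncurry a))
    (hag : ∀ᵐ s ∂m, Integrable fun x => a s x * g s x)
    (hQ : ∀ᵐ s ∂m, ∀ f : ℝ → ℝ, Measurable f → Integrable (fun x => f x * g s x) →
      (Integrable f (Q₁ s) ↔ Integrable f (Q₂ s)) ∧
      (Integrable f (Q₁ s) → ∫ x, f x ∂Q₁ s - ∫ x, f x ∂Q₂ s = ∫ x, f x * k s x))
    {φ θ : SchwartzMap ℝ ℝ}
    (hφ : ∀ᵐ s ∂m, s ∈ integrabilitySet Q₁ a (secondDeriv θ) →
      Integrable (fun x => secondDeriv φ x * a s x) (Q₁ s)) :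
    ∃ S : Set ℝ, S.Countable ∧ ∀ l ∉ S, ∀ᵐ s ∂m,
      ∫ x, secondDeriv (φ + l • θ) x * a s x ∂Q₁ s - ∫ x, secondDeriv (φ + l • θ) x * a s x ∂Q₂ s
        = ∫ x, secondDeriv (φ + l • θ) x *
          (a s x * (integrabilitySet Q₁ a (secondDeriv θ)).indicator (fun _ => k s x) s) := by
  obtain ⟨S, hS, h⟩ := ae_integrable_of_integrable_add_smul (m := m) Q₁ ha
    (secondDeriv φ).continuous.measurable (secondDeriv θ).continuous.measurable
  refine ⟨S, hS, fun l hl => ?_⟩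
  have e : ∀ x, secondDeriv (φ + l • θ) x = secondDeriv φ x + l * secondDeriv θ x := by
    intro x; simp
  filter_upwards [h l hl, hag, hQ, hφ] with s h1 h2 h3 h4
  have has : Measurable (a s) := ha.comp measurable_prodMk_left
  have hfg : Integrable fun x => secondDeriv (φ + l • θ) x * a s x * g s x := by
    simp_rw [mul_assoc]
    exact h2.bdd_mul (secondDeriv (φ + l • θ)).continuous.aestronglyMeasurable
      (Filter.Eventually.of_forall
        (secondDeriv (φ + l • θ)).toBoundedContinuousFunction.norm_coe_le_norm)
  obtain ⟨h5, h6⟩ := h3 (fun x => secondDeriv (φ + l • θ) x * a s x)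
    ((secondDeriv (φ + l • θ)).continuous.measurable.mul has) hfg
  by_cases hs : s ∈ integrabilitySet Q₁ a (secondDeriv θ)
  · have hi : Integrable (fun x => secondDeriv (φ + l • θ) x * a s x) (Q₁ s) := by
      refine ((h4 hs).add (Integrable.const_mul hs l)).congr
        (Filter.Eventually.of_forall fun x => ?_)
      simp only [Pi.add_apply, e]
      ring
    rw [h6 hi]
    simp [hs, mul_assoc]
  · have hi : ¬ Integrable (fun x => secondDeriv (φ + l • θ) x * a s x) (Q₁ s) := by
      intro hi
      refine hs (h1 (hi.congr (Filter.Eventually.of_forall fun x => ?_)))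
      simp only [e]
    rw [integral_undef hi, integral_undef (fun h => hi (h5.2 h))]
    simp [hs]

theorem ae_integrable_of_mem_integrabilitySet {m : Measure ℝ} [IsFiniteMeasure m]
    {Q : Kernel ℝ ℝ} [IsFiniteKernel Q] {a : ℝ → ℝ → ℝ} (ha : Measurable (Function.uncurry a))
    {ψ₁ ψ₂ : SchwartzMap ℝ ℝ} (hψ : ∀ x, 0 < |secondDeriv ψ₁ x| + |secondDeriv ψ₂ x|) :
    ∃ S : Set ℝ, S.Countable ∧ ∀ l ∉ S, ∀ᵐ s ∂m,
      s ∈ integrabilitySet Q a (secondDeriv (ψ₁ + l • ψ₂)) → ∀ φ : SchwartzMap ℝ ℝ,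
        HasCompactSupport φ → Integrable (fun x => secondDeriv φ x * a s x) (Q s) := by
  obtain ⟨S, hS, h⟩ := ae_integrable_of_integrable_add_smul (m := m) Q ha
    (secondDeriv ψ₁).continuous.measurable (secondDeriv ψ₂).continuous.measurable
  refine ⟨S, hS, fun l hl => ?_⟩
  filter_upwards [h l hl] with s h1 hs φ hφ
  have has : Measurable (a s) := ha.comp measurable_prodMk_left
  have e : ∀ x, secondDeriv (ψ₁ + l • ψ₂) x = secondDeriv ψ₁ x + l * secondDeriv ψ₂ x := by
    intro x; simp
  have hs' : Integrable (fun x => (secondDeriv ψ₁ x + l * secondDeriv ψ₂ x) * a s x) (Q s) := by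
    have h0 : Integrable (fun x => secondDeriv (ψ₁ + l • ψ₂) x * a s x) (Q s) := hs
    simpa only [e] using h0
  have h2 := h1 hs'
  have h3 : Integrable (fun x => secondDeriv ψ₁ x * a s x) (Q s) := by
    refine (hs'.sub (h2.const_mul l)).congr (Filter.Eventually.of_forall fun x => ?_)
    simp only [Pi.sub_apply]
    ring
  obtain ⟨C, hC⟩ := exists_abs_secondDeriv_le hψ hφ
  refine ((h3.abs.add h2.abs).const_mul C).mono'
    ((secondDeriv φ).continuous.measurable.mul has).aestronglyMeasurable
    (Filter.Eventually.of_forall fun x => ?_)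
  rw [Real.norm_eq_abs, abs_mul]
  simp only [Pi.add_apply, abs_mul]
  calc |secondDeriv φ x| * |a s x|
      ≤ C * (|secondDeriv ψ₁ x| + |secondDeriv ψ₂ x|) * |a s x| := by gcongr; exact hC x
    _ = _ := by ring

/-- The coefficient `a` times the difference of `k` and `k'`, each switched off outside a set of
times. -/
noncomputable def gatedDensity (a k k' : ℝ → ℝ → ℝ) (E E' : Set ℝ) (s x : ℝ) : ℝ :=
  a s x * (E.indicator (fun _ => k s x) s - E'.indicator (fun _ => k' s x) s)

theorem measurable_gatedDensity {a k k' : ℝ → ℝ → ℝ} {E E' : Set ℝ}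
    (ha : Measurable (Function.uncurry a)) (hk : Measurable (Function.uncurry k))
    (hk' : Measurable (Function.uncurry k')) (hE : MeasurableSet E) (hE' : MeasurableSet E') :
    Measurable (Function.uncurry (gatedDensity a k k' E E')) := by
  have h : ∀ {F : Set ℝ} {f : ℝ → ℝ → ℝ}, MeasurableSet F → Measurable (Function.uncurry f) →
      Measurable fun q : ℝ × ℝ => F.indicator (fun _ => f q.1 q.2) q.1 := fun {F f} hF hf =>
    hf.indicator (measurable_fst hF)
  exact ha.mul ((h hE hk).sub (h hE' hk'))

theorem abs_gatedDensity_le {a g k k' : ℝ → ℝ → ℝ} {E E' : Set ℝ} {s x : ℝ}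
    (hk : |k s x| ≤ |g s x|) (hk' : |k' s x| ≤ |g s x|) :
    |gatedDensity a k k' E E' s x| ≤ 2 * |a s x * g s x| := by
  have h1 : |E.indicator (fun _ => k s x) s| ≤ |g s x| := by
    by_cases h : s ∈ E <;> simp [h, hk]
  have h2 : |E'.indicator (fun _ => k' s x) s| ≤ |g s x| := by
    by_cases h : s ∈ E' <;> simp [h, hk']
  rw [gatedDensity, abs_mul, abs_mul]
  have := abs_sub (E.indicator (fun _ => k s x) s) (E'.indicator (fun _ => k' s x) s)
  nlinarith [abs_nonneg (a s x)]

theorem integrable_of_ae_ae_le {m : Measure ℝ} [SFinite m] {f h : ℝ × ℝ → ℝ} (hf : Measurable f)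
    (hh : Measurable h) (hhi : Integrable h (m.prod volume))
    (hle : ∀ᵐ s ∂m, ∀ᵐ x, |f (s, x)| ≤ h (s, x)) : Integrable f (m.prod volume) :=
  hhi.mono' hf.aestronglyMeasurable
    ((Measure.ae_prod_iff_ae_ae (p := fun q => ‖f q‖ ≤ h q) (measurableSet_le hf.norm hh)).2 hle)

theorem LinearMap.eq_zero_or_eq_of_forall_notMem_countable {V : Type*} [AddCommGroup V] [Module ℝ V]
    (f g : V →ₗ[ℝ] ℝ) {v w : V} {S : Set ℝ} (hS : S.Countable)
    (h : ∀ l ∉ S, f (v + l • w) = 0 ∨ g (v + l • w) = 0) : f v = 0 ∨ g v = 0 := by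
  have key : ∀ f : V →ₗ[ℝ] ℝ, f v ≠ 0 → {l : ℝ | f (v + l • w) = 0}.Subsingleton := by
    intro f hf l hl l' hl'
    simp only [mem_ofPred_eq, map_add, map_smul, smul_eq_mul] at hl hl'
    have hw : f w ≠ 0 := by
      rintro h0
      rw [h0] at hl
      exact hf (by simpa using hl)
    exact mul_right_cancel₀ hw (by linarith)
  by_contra! hne
  refine Cardinal.not_countable_real
    ((hS.union ((key f hne.1).countable.union (key g hne.2).countable)).mono fun l _ => ?_)
  by_cases hl : l ∈ S
  · exact Or.inl hl
  · exact Or.inr (h l hl)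

theorem LinearMap.forall_eq_zero_or_forall_eq_zero {V : Type*} [AddCommGroup V] [Module ℝ V]
    (f g : V →ₗ[ℝ] ℝ) (p : Submodule ℝ V) (h : ∀ v ∈ p, f v = 0 ∨ g v = 0) :
    (∀ v ∈ p, f v = 0) ∨ ∀ v ∈ p, g v = 0 := by
  by_contra! hne
  obtain ⟨⟨v, hv, hfv⟩, w, hw, hgw⟩ := hne
  have hgv : g v = 0 := (h v hv).resolve_left hfv
  have hfw : f w = 0 := (h w hw).resolve_right hgw
  rcases h (v + w) (p.add_mem hv hw) with h | h
  · exact hfv (by simpa [hfw] using h)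
  · exact hgw (by simpa [hgv] using h)

theorem integrable_integral_secondDeriv_mul {m : Measure ℝ} [SFinite m] {K : ℝ → ℝ → ℝ}
    (hK : Integrable (fun q : ℝ × ℝ => K q.1 q.2) (m.prod volume)) (φ : SchwartzMap ℝ ℝ) :
    Integrable (fun s => ∫ x, secondDeriv φ x * K s x) m := by
  have h : Integrable (fun q : ℝ × ℝ => secondDeriv φ q.2 * K q.1 q.2) (m.prod volume) :=
    hK.bdd_mul ((secondDeriv φ).continuous.comp continuous_snd).aestronglyMeasurable
      (Filter.Eventually.of_forall fun q =>
        (secondDeriv φ).toBoundedContinuousFunction.norm_coe_le_norm q.2)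
  exact h.integral_prod_left

theorem exists_linearMap_integral_secondDeriv_mul {T : ℝ} {K : ℝ → ℝ → ℝ}
    (hK : Integrable (fun q : ℝ × ℝ => K q.1 q.2) ((volume.restrict (Ioc 0 T)).prod volume))
    {t : ℝ} (ht : t ∈ Icc 0 T) :
    ∃ L : SchwartzMap ℝ ℝ →ₗ[ℝ] ℝ, ∀ φ, L φ = ∫ s in 0..t, ∫ x, secondDeriv φ x * K s x := by
  have hle : volume.restrict (Ioc 0 t) ≤ volume.restrict (Ioc 0 T) :=
    Measure.restrict_mono (Ioc_subset_Ioc_right ht.2) le_rfl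
  have hi : ∀ φ, Integrable (fun s => ∫ x, secondDeriv φ x * K s x) (volume.restrict (Ioc 0 t)) :=
    fun φ => (integrable_integral_secondDeriv_mul hK φ).mono_measure hle
  have hs : ∀ᵐ s ∂volume.restrict (Ioc 0 t), ∀ φ, Integrable fun x => secondDeriv φ x * K s x := by
    filter_upwards [hle.absolutelyContinuous.ae_le hK.prod_right_ae] with s hs φ
    exact hs.bdd_mul (secondDeriv φ).continuous.aestronglyMeasurable
      (Filter.Eventually.of_forall (secondDeriv φ).toBoundedContinuousFunction.norm_coe_le_norm)
  refine ⟨{ toFun := fun φ => ∫ s in 0..t, ∫ x, secondDeriv φ x * K s x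
            map_add' := fun φ ψ => ?_
            map_smul' := fun c φ => ?_ }, fun φ => rfl⟩
  · simp only [intervalIntegral.integral_of_le ht.1]
    rw [← integral_add (hi φ) (hi ψ)]
    refine integral_congr_ae ?_
    filter_upwards [hs] with s hs
    rw [← integral_add (hs φ) (hs ψ)]
    simp [add_mul]
  · simp only [intervalIntegral.integral_of_le ht.1, RingHom.id_apply, smul_eq_mul]
    rw [← integral_const_mul]
    refine integral_congr_ae (Filter.Eventually.of_forall fun s => ?_)
    simp only [map_smul, smul_apply, smul_eq_mul, mul_assoc, integral_const_mul]

theorem integral_sub_integral_eq_or_eq_zero {m : Measure ℝ} {F₁ F₂ G : ℝ → ℝ} (hG : Integrable G m)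
    (h : ∀ᵐ s ∂m, F₁ s - F₂ s = G s) :
    ∫ s, F₁ s ∂m - ∫ s, F₂ s ∂m = 0 ∨ ∫ s, F₁ s ∂m - ∫ s, F₂ s ∂m = ∫ s, G s ∂m := by
  by_cases h1 : Integrable F₁ m
  · have h2 : Integrable F₂ m := by
      refine (h1.sub hG).congr ?_
      filter_upwards [h] with s hs
      simp only [Pi.sub_apply, ← hs]
      ring
    right
    rw [← integral_sub h1 h2]
    exact integral_congr_ae h
  · have h2 : ¬ Integrable F₂ m := by
      intro h2
      refine h1 ((h2.add hG).congr ?_)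
      filter_upwards [h] with s hs
      simp only [Pi.add_apply, ← hs]
      ring
    left
    rw [integral_undef h1, integral_undef h2, sub_zero]

theorem dichotomy_of_kernels {T : ℝ} {P₁ P₂ N₁ N₂ : Kernel ℝ ℝ} [IsFiniteKernel P₁]
    [IsFiniteKernel N₁] {a g k k' : ℝ → ℝ → ℝ} (ha : Measurable (Function.uncurry a))
    (hg : Measurable (Function.uncurry g)) (hkm : Measurable (Function.uncurry k))
    (hkm' : Measurable (Function.uncurry k'))
    (hag : Integrable (fun q : ℝ × ℝ => a q.1 q.2 * g q.1 q.2)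
      ((volume.restrict (Ioc 0 T)).prod volume))
    (hk : ∀ᵐ s ∂volume.restrict (Ioc 0 T), ∀ᵐ x, |k s x| ≤ |g s x| ∧ |k' s x| ≤ |g s x|)
    (hP : ∀ᵐ s ∂volume.restrict (Ioc 0 T), ∀ f : ℝ → ℝ, Measurable f →
      Integrable (fun x => f x * g s x) → (Integrable f (P₁ s) ↔ Integrable f (P₂ s)) ∧
      (Integrable f (P₁ s) → ∫ x, f x ∂P₁ s - ∫ x, f x ∂P₂ s = ∫ x, f x * k s x))
    (hN : ∀ᵐ s ∂volume.restrict (Ioc 0 T), ∀ f : ℝ → ℝ, Measurable f →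
      Integrable (fun x => f x * g s x) → (Integrable f (N₁ s) ↔ Integrable f (N₂ s)) ∧
      (Integrable f (N₁ s) → ∫ x, f x ∂N₁ s - ∫ x, f x ∂N₂ s = ∫ x, f x * k' s x))
    {z : ℝ → SchwartzMap ℝ ℝ →ₗ[ℝ] ℝ}
    (hz : ∀ t ∈ Icc 0 T, ∀ φ, z t φ =
      (∫ s in 0..t, (∫ x, secondDeriv φ x * a s x ∂P₁ s - ∫ x, secondDeriv φ x * a s x ∂N₁ s)) -
      ∫ s in 0..t, (∫ x, secondDeriv φ x * a s x ∂P₂ s - ∫ x, secondDeriv φ x * a s x ∂N₂ s)) :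
    ∃ E E' : Set ℝ, MeasurableSet E ∧ MeasurableSet E' ∧ ∀ t ∈ Icc 0 T,
      (∀ φ : SchwartzMap ℝ ℝ, HasCompactSupport φ → z t φ = 0) ∨
      ∀ φ : SchwartzMap ℝ ℝ, HasCompactSupport φ →
        z t φ = ∫ s in 0..t, ∫ x, secondDeriv φ x * gatedDensity a k k' E E' s x := by
  obtain ⟨ψ₁, ψ₂, hψ⟩ := exists_secondDeriv_abs_add_pos
  obtain ⟨S, hS, hSP⟩ := ae_integrable_of_mem_integrabilitySet
    (m := volume.restrict (Ioc 0 T)) (Q := P₁) ha hψ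
  obtain ⟨S', hS', hSN⟩ := ae_integrable_of_mem_integrabilitySet
    (m := volume.restrict (Ioc 0 T)) (Q := N₁) ha hψ
  obtain ⟨l, hl⟩ : ∃ l, l ∉ S ∪ S' := by
    by_contra! h
    exact Cardinal.not_countable_real ((hS.union hS').mono fun l _ => h l)
  rw [mem_union, not_or] at hl
  replace hSP := hSP l hl.1
  replace hSN := hSN l hl.2
  set θ := ψ₁ + l • ψ₂
  have hθ : Measurable (secondDeriv θ) := (secondDeriv θ).continuous.measurable
  set E := integrabilitySet P₁ a (secondDeriv θ) with hEdef
  set E' := integrabilitySet N₁ a (secondDeriv θ) with hEdef'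
  have hE : MeasurableSet E := measurableSet_integrabilitySet P₁ ha hθ
  have hE' : MeasurableSet E' := measurableSet_integrabilitySet N₁ ha hθ
  have hKm := measurable_gatedDensity ha hkm hkm' hE hE'
  have hK : Integrable (fun q : ℝ × ℝ => gatedDensity a k k' E E' q.1 q.2)
      ((volume.restrict (Ioc 0 T)).prod volume) := by
    refine integrable_of_ae_ae_le hKm ((ha.mul hg).norm.const_mul 2) (hag.norm.const_mul 2) ?_
    filter_upwards [hk] with s hs
    filter_upwards [hs] with x hx
    exact abs_gatedDensity_le hx.1 hx.2
  have hags : ∀ᵐ s ∂volume.restrict (Ioc 0 T), Integrable fun x => a s x * g s x :=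
    hag.prod_right_ae
  refine ⟨E, E', hE, hE', fun t ht => ?_⟩
  obtain ⟨L, hL⟩ := exists_linearMap_integral_secondDeriv_mul hK ht
  have hle : volume.restrict (Ioc 0 t) ≤ volume.restrict (Ioc 0 T) :=
    Measure.restrict_mono (Ioc_subset_Ioc_right ht.2) le_rfl
  let p : Submodule ℝ (SchwartzMap ℝ ℝ) :=
    { carrier := {φ | HasCompactSupport φ}
      add_mem' := fun {φ ψ} hφ hψ => HasCompactSupport.add (f := φ) (f' := ψ) hφ hψ
      zero_mem' := HasCompactSupport.zero
      smul_mem' := fun c φ hφ => HasCompactSupport.smul_left (f := fun _ => c) (f' := φ) hφ }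
  have key := LinearMap.forall_eq_zero_or_forall_eq_zero (z t) (z t - L) p ?_
  · refine key.imp (fun h φ hφ => h φ hφ) fun h φ hφ => ?_
    rw [← hL, ← sub_eq_zero]
    exact h φ hφ
  intro φ hφ
  obtain ⟨R, hR, hRP⟩ := ae_integral_sub_integral_eq_indicator (φ := φ) (θ := θ) ha hags hP
    (hSP.mono fun s hs h => hs h φ hφ)
  obtain ⟨R', hR', hRN⟩ := ae_integral_sub_integral_eq_indicator (φ := φ) (θ := θ) ha hags hN
    (hSN.mono fun s hs h => hs h φ hφ)
  refine LinearMap.eq_zero_or_eq_of_forall_notMem_countable (z t) (z t - L) (w := θ)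
    (hR.union hR') fun μ hμ => ?_
  rw [mem_union, not_or] at hμ
  rw [LinearMap.sub_apply, sub_eq_zero, hL, hz t ht]
  simp only [intervalIntegral.integral_of_le ht.1]
  refine integral_sub_integral_eq_or_eq_zero
    ((integrable_integral_secondDeriv_mul hK (φ + μ • θ)).mono_measure hle) ?_
  refine hle.absolutelyContinuous.ae_le ?_
  filter_upwards [hRP μ hμ.1, hRN μ hμ.2, hags, hk] with s h1 h2 h3 h4
  have hinteg : ∀ (f : ℝ → ℝ → ℝ) (F : Set ℝ), Measurable (Function.uncurry f) →
      (∀ᵐ x, |f s x| ≤ |g s x|) → Integrable fun x =>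
        secondDeriv (φ + μ • θ) x * (a s x * F.indicator (fun _ => f s x) s) := by
    intro f F hf hfg
    have hfs : Measurable fun x => F.indicator (fun _ => f s x) s := by
      by_cases hs : s ∈ F
      · simp only [hs, indicator_of_mem]
        exact hf.comp measurable_prodMk_left
      · simp [hs]
    refine Integrable.bdd_mul ?_ (secondDeriv (φ + μ • θ)).continuous.aestronglyMeasurable
      (Filter.Eventually.of_forall
        (secondDeriv (φ + μ • θ)).toBoundedContinuousFunction.norm_coe_le_norm)
    refine h3.mono ((ha.comp measurable_prodMk_left).mul hfs).aestronglyMeasurable ?_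
    filter_upwards [hfg] with x hx
    rw [norm_mul, norm_mul]
    gcongr
    by_cases hs : s ∈ F <;> simp [hs, hx]
  calc _ = (∫ x, secondDeriv (φ + μ • θ) x * a s x ∂P₁ s -
          ∫ x, secondDeriv (φ + μ • θ) x * a s x ∂P₂ s) -
        (∫ x, secondDeriv (φ + μ • θ) x * a s x ∂N₁ s -
          ∫ x, secondDeriv (φ + μ • θ) x * a s x ∂N₂ s) := by ring
    _ = _ := by
      rw [h1, h2, ← integral_sub (hinteg k E hkm (h4.mono fun x hx => hx.1))
        (hinteg k' E' hkm' (h4.mono fun x hx => hx.2))]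
      refine integral_congr_ae (Filter.Eventually.of_forall fun x => ?_)
      simp only [gatedDensity]
      ring

open Filter Topology in
theorem exists_compactlySupported_approx {f : ℝ → ℝ} (hf : ContDiff ℝ ∞ f) {M : ℝ}
    (h0 : ∀ x, |f x| ≤ M) (h1 : ∀ x, |deriv f x| ≤ M) (h2 : ∀ x, |deriv (deriv f) x| ≤ M) :
    ∃ (φ : ℕ → SchwartzMap ℝ ℝ) (C : ℝ), (∀ n, HasCompactSupport (φ n)) ∧
      (∀ n x, |φ n x| ≤ C) ∧ (∀ n x, |secondDeriv (φ n) x| ≤ C) ∧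
      (∀ x, Tendsto (fun n => φ n x) atTop (𝓝 (f x))) ∧
      ∀ x, Tendsto (fun n => secondDeriv (φ n) x) atTop (𝓝 (deriv (deriv f) x)) := by
  let χ : ContDiffBump (0 : ℝ) := ⟨1, 2, one_pos, one_lt_two⟩
  have hχ : ContDiff ℝ ∞ χ := χ.contDiff
  have hχ1 : ContDiff ℝ ∞ (deriv χ) := (contDiff_infty_iff_deriv.1 hχ).2
  have hχ2 : ContDiff ℝ ∞ (deriv (deriv χ)) := (contDiff_infty_iff_deriv.1 hχ1).2
  obtain ⟨B, hB⟩ := χ.hasCompactSupport.exists_bound_of_continuous hχ.continuous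
  obtain ⟨B', hB'⟩ := χ.hasCompactSupport.deriv.exists_bound_of_continuous hχ1.continuous
  obtain ⟨B'', hB''⟩ := χ.hasCompactSupport.deriv.deriv.exists_bound_of_continuous hχ2.continuous
  have hM : 0 ≤ M := (abs_nonneg _).trans (h0 0)
  have hB0 : 0 ≤ B := (norm_nonneg _).trans (hB 0)
  have hB'0 : 0 ≤ B' := (norm_nonneg _).trans (hB' 0)
  have hB''0 : 0 ≤ B'' := (norm_nonneg _).trans (hB'' 0)
  set c : ℕ → ℝ := fun n => ((n : ℝ) + 1)⁻¹ with hc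
  have hc0 : ∀ n, 0 < c n := fun n => by positivity
  have hc1 : ∀ n, c n ≤ 1 := fun n => inv_le_one_of_one_le₀ (by simp)
  have hsm : ∀ n, ContDiff ℝ ∞ fun x => χ (c n * x) := fun n =>
    hχ.comp (contDiff_const.mul contDiff_id)
  have hcs : ∀ n, HasCompactSupport fun x => χ (c n * x) * f x := fun n =>
    HasCompactSupport.mul_right (f := fun x => χ (c n * x)) (f' := f)
      (χ.hasCompactSupport.comp_homeomorph (Homeomorph.mulLeft₀ (c n) (hc0 n).ne'))
  let φ : ℕ → SchwartzMap ℝ ℝ := fun n => (hcs n).toSchwartzMap ((hsm n).mul hf)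
  have hφ : ∀ n x, φ n x = χ (c n * x) * f x := fun n x => rfl
  have hder' : ∀ g : ℝ → ℝ, ContDiff ℝ ∞ g → ∀ x, HasDerivAt g (deriv g x) x := fun g hg x =>
    (hg.differentiable (by simp) x).hasDerivAt
  have hder : ∀ g : ℝ → ℝ, ContDiff ℝ ∞ g → ∀ n x,
      HasDerivAt (fun x => g (c n * x)) (c n * deriv g (c n * x)) x := fun g hg n x =>
    ((hder' g hg (c n * x)).comp x ((hasDerivAt_id x).const_mul (c n))).congr_deriv (by ring)
  have hf1 : ContDiff ℝ ∞ (deriv f) := (contDiff_infty_iff_deriv.1 hf).2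
  have hd : ∀ n, deriv (φ n) =
      fun x => c n * deriv χ (c n * x) * f x + χ (c n * x) * deriv f x := by
    intro n
    funext x
    exact ((hder χ hχ n x).mul (hder' f hf x)).deriv
  have hdd : ∀ n x, secondDeriv (φ n) x = c n * (c n * deriv (deriv χ) (c n * x)) * f x +
      2 * (c n * deriv χ (c n * x) * deriv f x) + χ (c n * x) * deriv (deriv f) x := by
    intro n x
    rw [secondDeriv_apply, hd]
    refine ((((hder _ hχ1 n x).const_mul (c n)).mul (hder' f hf x)).add
      ((hder χ hχ n x).mul (hder' _ hf1 x))).deriv.trans ?_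
    ring
  have hev : ∀ x, ∀ᶠ n in atTop, (φ n : ℝ → ℝ) =ᶠ[𝓝 x] f := by
    intro x
    have ht : Tendsto (fun n => c n * (|x| + 1)) atTop (𝓝 (0 * (|x| + 1))) :=
      (tendsto_inv_atTop_zero.comp
        (tendsto_atTop_add_const_right _ 1 tendsto_natCast_atTop_atTop)).mul_const _
    rw [zero_mul] at ht
    filter_upwards [ht.eventually_le_const one_pos] with n hn
    filter_upwards [Metric.ball_mem_nhds x one_pos] with y hy
    rw [hφ, χ.one_of_mem_closedBall, one_mul]
    rw [mem_closedBall_zero_iff, norm_mul, Real.norm_eq_abs, Real.norm_eq_abs, abs_of_pos (hc0 n)]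
    refine le_trans ?_ hn
    have : |y| ≤ |x| + 1 := by
      rw [Metric.mem_ball, Real.dist_eq] at hy
      have := abs_sub_abs_le_abs_sub y x
      linarith
    exact mul_le_mul_of_nonneg_left this (hc0 n).le
  refine ⟨φ, B * M + (B'' * M + 2 * (B' * M) + B * M), hcs,
    fun n x => ?_, fun n x => ?_, fun x => ?_, fun x => ?_⟩
  · rw [hφ, abs_mul]
    have h := mul_le_mul (hB (c n * x)) (h0 x) (abs_nonneg _) hB0
    rw [Real.norm_eq_abs] at h
    nlinarith [mul_nonneg hB0 hM, mul_nonneg hB'0 hM, mul_nonneg hB''0 hM]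
  · have e0 := mul_le_mul (hB (c n * x)) (h2 x) (abs_nonneg _) hB0
    have e1 := mul_le_mul (mul_le_mul (hc1 n) (hB' (c n * x)) (norm_nonneg _) zero_le_one)
      (h1 x) (abs_nonneg _) (by simpa)
    have e2 := mul_le_mul (mul_le_mul (hc1 n) (mul_le_mul (hc1 n) (hB'' (c n * x)) (norm_nonneg _)
      zero_le_one) (by positivity) zero_le_one) (h0 x) (abs_nonneg _) (by simpa)
    rw [hdd]
    refine (abs_add_three _ _ _).trans ?_
    simp only [abs_mul, abs_of_pos (hc0 n), abs_two, Real.norm_eq_abs, one_mul] at e0 e1 e2 ⊢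
    nlinarith [mul_nonneg hB0 hM]
  · exact tendsto_const_nhds.congr' ((hev x).mono fun n hn => hn.eq_of_nhds.symm)
  · exact tendsto_const_nhds.congr' ((hev x).mono fun n hn => hn.deriv.deriv_eq.symm)

theorem sintegral_sub_sintegral_eq_integral {μ₁ μ₂ : SignedMeasure ℝ} {u : ℝ → ℝ}
    (hum : Measurable u) (hu : Integrable u)
    (h : ∀ A : Set ℝ, MeasurableSet A → (μ₁ - μ₂) A = ∫ x in A, u x) (f : ℝ →ᵇ ℝ) :
    sintegral μ₁ f - sintegral μ₂ f = ∫ x, f x * u x := by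
  have hf : ∀ ν : Measure ℝ, IsFiniteMeasure ν → Integrable f ν := fun ν _ => f.integrable ν
  have hQ := jordan_add_eq_of_sub_eq_density hu h
  rw [← densityMeasure_max u, ← densityMeasure_max fun x => -u x] at hQ
  have hb : ∀ v : ℝ → ℝ, Integrable v → Integrable fun x => f x * max (v x) 0 := fun v hv =>
    (hv.pos_part).bdd_mul f.continuous.aestronglyMeasurable
      (Filter.Eventually.of_forall f.norm_coe_le_norm)
  have e := (integral_sub_integral_of_add_densityMeasure_eq (hum.neg.max measurable_const)
    (hum.max measurable_const) (fun x => le_max_right _ _) (fun x => le_max_right _ _) hQ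
    (hb _ hu.neg) (hb _ hu)).2 (hf _ inferInstance)
  rw [integral_add_measure (hf _ inferInstance) (hf _ inferInstance),
    integral_add_measure (hf _ inferInstance) (hf _ inferInstance)] at e
  have e' : ∀ x, f x * (max (u x) 0 - max (-u x) 0) = f x * u x := by
    intro x
    rcases le_total 0 (u x) with h | h
    · rw [max_eq_left h, max_eq_right (by linarith), sub_zero]
    · rw [max_eq_right h, max_eq_left (by linarith), zero_sub, neg_neg]
  replace e := e.trans (integral_congr_ae (Filter.Eventually.of_forall e'))
  rw [sintegral, sintegral, ← e]
  ring

open Filter Topology in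
theorem tendsto_sintegral (μ : SignedMeasure ℝ) {f : ℝ → ℝ} {φ : ℕ → ℝ → ℝ} {C : ℝ}
    (hφ : ∀ n, Measurable (φ n)) (hC : ∀ n x, |φ n x| ≤ C)
    (h : ∀ x, Tendsto (fun n => φ n x) atTop (𝓝 (f x))) :
    Tendsto (fun n => sintegral μ (φ n)) atTop (𝓝 (sintegral μ f)) := by
  have key : ∀ ν : Measure ℝ, IsFiniteMeasure ν →
      Tendsto (fun n => ∫ x, φ n x ∂ν) atTop (𝓝 (∫ x, f x ∂ν)) := fun ν _ =>
    tendsto_integral_of_dominated_convergence (fun _ => C)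
      (fun n => (hφ n).aestronglyMeasurable) (integrable_const C)
      (fun n => Eventually.of_forall (hC n)) (Eventually.of_forall h)
  exact (key _ inferInstance).sub (key _ inferInstance)

open Filter Topology in
theorem tendsto_integral_integral_mul {m : Measure ℝ} [SFinite m] {K : ℝ → ℝ → ℝ}
    (hK : Integrable (fun q : ℝ × ℝ => K q.1 q.2) (m.prod volume)) {f : ℝ → ℝ}
    {φ : ℕ → ℝ → ℝ} {C : ℝ} (hf : Continuous f) (hfC : ∀ x, |f x| ≤ C)
    (hφ : ∀ n, Continuous (φ n)) (hC : ∀ n x, |φ n x| ≤ C)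
    (h : ∀ x, Tendsto (fun n => φ n x) atTop (𝓝 (f x))) :
    Tendsto (fun n => ∫ s, (∫ x, φ n x * K s x) ∂m) atTop
      (𝓝 (∫ s, (∫ x, f x * K s x) ∂m)) := by
  have hi : ∀ f : ℝ → ℝ, Continuous f → (∀ x, |f x| ≤ C) →
      Integrable (fun q : ℝ × ℝ => f q.2 * K q.1 q.2) (m.prod volume) := fun f hf hC =>
    hK.bdd_mul (hf.comp continuous_snd).aestronglyMeasurable (Eventually.of_forall fun q => hC q.2)
  have hp : ∀ f : ℝ → ℝ, Continuous f → (∀ x, |f x| ≤ C) →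
      ∫ s, (∫ x, f x * K s x) ∂m = ∫ q, f q.2 * K q.1 q.2 ∂m.prod volume := fun f hf hC =>
    (integral_prod _ (hi f hf hC)).symm
  rw [hp f hf hfC]
  simp only [fun n => hp (φ n) (hφ n) (hC n)]
  refine tendsto_integral_of_dominated_convergence (fun q => C * |K q.1 q.2|)
    (fun n => (hi _ (hφ n) (hC n)).aestronglyMeasurable) (hK.norm.const_mul C)
    (fun n => Eventually.of_forall fun q => ?_)
    (Eventually.of_forall fun q => (h q.2).mul_const _)
  rw [norm_mul]
  exact mul_le_mul_of_nonneg_right (hC n q.2) (norm_nonneg _)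

/-- Test functions may be replaced by smooth functions with bounded derivatives in the
alternative satisfied by the difference of two measures. -/
theorem forall_bounded_of_forall_compactlySupported {m : Measure ℝ} [SFinite m] {K : ℝ → ℝ → ℝ}
    (hK : Integrable (fun q : ℝ × ℝ => K q.1 q.2) (m.prod volume)) {μ₁ μ₂ : SignedMeasure ℝ}
    (h : ∀ φ : SchwartzMap ℝ ℝ, HasCompactSupport φ →
      sintegral μ₁ φ - sintegral μ₂ φ = ∫ s, (∫ x, secondDeriv φ x * K s x) ∂m)
    {f : ℝ → ℝ} (hf : ContDiff ℝ ∞ f) {M : ℝ}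
    (h0 : ∀ x, |f x| ≤ M) (h1 : ∀ x, |deriv f x| ≤ M) (h2 : ∀ x, |deriv (deriv f) x| ≤ M) :
    sintegral μ₁ f - sintegral μ₂ f = ∫ s, (∫ x, deriv (deriv f) x * K s x) ∂m := by
  obtain ⟨φ, C, hcs, hC, hC', hφ, hφ'⟩ := exists_compactlySupported_approx hf h0 h1 h2
  have hlim := (tendsto_sintegral μ₁ (fun n => (φ n).continuous.measurable) hC hφ).sub
    (tendsto_sintegral μ₂ (fun n => (φ n).continuous.measurable) hC hφ)
  simp only [fun n => h (φ n) (hcs n)] at hlim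
  refine tendsto_nhds_unique hlim (tendsto_integral_integral_mul hK ?_
    (fun x => le_of_tendsto (hφ' x).abs (Filter.Eventually.of_forall fun n => hC' n x))
    (fun n => (secondDeriv (φ n)).continuous) hC' hφ')
  exact (contDiff_infty_iff_deriv.1 (contDiff_infty_iff_deriv.1 hf).2).2.continuous

/-- The Fourier transform of a finite signed measure. -/
noncomputable def signedFourier (μ : SignedMeasure ℝ) (ξ : ℝ) : ℂ :=
  charFun μ.toJordanDecomposition.posPart (-(2 * Real.pi * ξ)) -
    charFun μ.toJordanDecomposition.negPart (-(2 * Real.pi * ξ))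

theorem charFun_neg_eq_cos_sub_sin (ν : Measure ℝ) [IsFiniteMeasure ν] (w : ℝ) :
    charFun ν (-w) = ((∫ x, Real.cos (w * x) ∂ν : ℝ) : ℂ) -
      Complex.I * ((∫ x, Real.sin (w * x) ∂ν : ℝ) : ℂ) := by
  have hc : Integrable (fun x => Real.cos (w * x)) ν :=
    (integrable_const (1 : ℝ)).mono' (by fun_prop)
      (Filter.Eventually.of_forall fun x => Real.abs_cos_le_one _)
  have hs : Integrable (fun x => Real.sin (w * x)) ν :=
    (integrable_const (1 : ℝ)).mono' (by fun_prop)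
      (Filter.Eventually.of_forall fun x => Real.abs_sin_le_one _)
  rw [charFun_apply_real, ← integral_complex_ofReal, ← integral_complex_ofReal,
    ← integral_const_mul, ← integral_sub hc.ofReal (hs.ofReal.const_mul _)]
  refine integral_congr_ae (Filter.Eventually.of_forall fun x => ?_)
  have : (((-w : ℝ) : ℂ) * x * Complex.I) = ((-(w * x) : ℝ) : ℂ) * Complex.I := by
    push_cast; ring
  simp only [this, Complex.exp_mul_I, ← Complex.ofReal_cos, ← Complex.ofReal_sin, Real.cos_neg,
    Real.sin_neg]
  push_cast
  ring

theorem signedFourier_eq (μ : SignedMeasure ℝ) (ξ : ℝ) :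
    signedFourier μ ξ = (sintegral μ (fun x => Real.cos (2 * Real.pi * ξ * x)) : ℂ) -
      Complex.I * (sintegral μ (fun x => Real.sin (2 * Real.pi * ξ * x)) : ℂ) := by
  rw [signedFourier, charFun_neg_eq_cos_sub_sin, charFun_neg_eq_cos_sub_sin, sintegral, sintegral]
  push_cast
  ring

theorem continuous_signedFourier (μ : SignedMeasure ℝ) : Continuous (signedFourier μ) := by
  have h : Continuous fun ξ : ℝ => -(2 * Real.pi * ξ) := by fun_prop
  exact (continuous_charFun.comp h).sub (continuous_charFun.comp h)

theorem eq_of_signedFourier_eq {μ₁ μ₂ : SignedMeasure ℝ}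
    (h : ∀ ξ, signedFourier μ₁ ξ = signedFourier μ₂ ξ) : μ₁ = μ₂ := by
  have hadd : ∀ (ν ν' : Measure ℝ) [IsFiniteMeasure ν] [IsFiniteMeasure ν'] (w : ℝ),
      charFun (ν + ν') w = charFun ν w + charFun ν' w := by
    intro ν ν' _ _ w
    have hi : ∀ (ν : Measure ℝ) [IsFiniteMeasure ν],
        Integrable (fun x : ℝ => Complex.exp (w * x * Complex.I)) ν := fun ν _ =>
      (integrable_const (1 : ℝ)).mono' (by fun_prop) (Filter.Eventually.of_forall fun x => by
        rw [← Complex.ofReal_mul, Complex.norm_exp_ofReal_mul_I])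
    simp only [charFun_apply_real]
    exact integral_add_measure (hi ν) (hi ν')
  have hm : μ₁.toJordanDecomposition.posPart + μ₂.toJordanDecomposition.negPart =
      μ₂.toJordanDecomposition.posPart + μ₁.toJordanDecomposition.negPart := by
    refine Measure.ext_of_charFun (funext fun w => ?_)
    have e := h (-(w / (2 * Real.pi)))
    have hw : -(2 * Real.pi * -(w / (2 * Real.pi))) = w := by field_simp
    simp only [signedFourier, hw] at e
    rw [hadd, hadd]
    linear_combination e
  ext A hA
  rw [signedMeasure_apply_eq _ hA, signedMeasure_apply_eq _ hA]
  have e : (μ₁.toJordanDecomposition.posPart + μ₂.toJordanDecomposition.negPart).real A =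
      (μ₂.toJordanDecomposition.posPart + μ₁.toJordanDecomposition.negPart).real A := by rw [hm]
  rw [measureReal_add_apply, measureReal_add_apply] at e
  linarith

theorem fourier_ofReal_eq_cos_sub_sin {u : ℝ → ℝ} (hu : Integrable u) (ξ : ℝ) :
    𝓕 (fun x => (u x : ℂ)) ξ = ((∫ x, Real.cos (2 * Real.pi * ξ * x) * u x : ℝ) : ℂ) -
      Complex.I * ((∫ x, Real.sin (2 * Real.pi * ξ * x) * u x : ℝ) : ℂ) := by
  have hc : Integrable (fun x => Real.cos (2 * Real.pi * ξ * x) * u x) :=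
    hu.bdd_mul (c := 1) (by fun_prop) (Filter.Eventually.of_forall fun x => Real.abs_cos_le_one _)
  have hs : Integrable (fun x => Real.sin (2 * Real.pi * ξ * x) * u x) :=
    hu.bdd_mul (c := 1) (by fun_prop) (Filter.Eventually.of_forall fun x => Real.abs_sin_le_one _)
  rw [Real.fourier_real_eq_integral_exp_smul, ← integral_complex_ofReal, ← integral_complex_ofReal,
    ← integral_const_mul, ← integral_sub hc.ofReal (hs.ofReal.const_mul _)]
  refine integral_congr_ae (Filter.Eventually.of_forall fun x => ?_)
  have : ((-2 * Real.pi * x * ξ : ℝ) : ℂ) * Complex.I =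
      ((-(2 * Real.pi * ξ * x) : ℝ) : ℂ) * Complex.I := by
    push_cast; ring
  simp only [this, Complex.exp_mul_I, ← Complex.ofReal_cos, ← Complex.ofReal_sin, Real.cos_neg,
    Real.sin_neg, smul_eq_mul]
  push_cast
  ring

theorem deriv_deriv_cos_mul (w : ℝ) :
    (∀ x, deriv (fun x => Real.cos (w * x)) x = -(w * Real.sin (w * x))) ∧
      ∀ x, deriv (deriv fun x => Real.cos (w * x)) x = -(w ^ 2 * Real.cos (w * x)) := by
  have hl : ∀ x, HasDerivAt (fun x : ℝ => w * x) w x := fun x => by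
    simpa using (hasDerivAt_id x).const_mul w
  have h : deriv (fun x => Real.cos (w * x)) = fun x => -(w * Real.sin (w * x)) := by
    funext x
    rw [(hl x).cos.deriv]
    ring
  refine ⟨fun x => by rw [h], fun x => ?_⟩
  rw [h, ((hl x).sin.const_mul w).fun_neg.deriv]
  ring

theorem deriv_deriv_sin_mul (w : ℝ) :
    (∀ x, deriv (fun x => Real.sin (w * x)) x = w * Real.cos (w * x)) ∧
      ∀ x, deriv (deriv fun x => Real.sin (w * x)) x = -(w ^ 2 * Real.sin (w * x)) := by
  have hl : ∀ x, HasDerivAt (fun x : ℝ => w * x) w x := fun x => by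
    simpa using (hasDerivAt_id x).const_mul w
  have h : deriv (fun x => Real.sin (w * x)) = fun x => w * Real.cos (w * x) := by
    funext x
    rw [(hl x).sin.deriv]
    ring
  refine ⟨fun x => by rw [h], fun x => ?_⟩
  rw [h, ((hl x).cos.const_mul w).deriv]
  ring

theorem signedFourier_sub_eq {m : Measure ℝ} [SFinite m] {K : ℝ → ℝ → ℝ}
    (hK : Integrable (fun q : ℝ × ℝ => K q.1 q.2) (m.prod volume)) {μ₁ μ₂ : SignedMeasure ℝ}
    (h : ∀ φ : SchwartzMap ℝ ℝ, HasCompactSupport φ →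
      sintegral μ₁ φ - sintegral μ₂ φ = ∫ s, (∫ x, secondDeriv φ x * K s x) ∂m) (ξ : ℝ) :
    signedFourier μ₁ ξ - signedFourier μ₂ ξ =
      -((4 * Real.pi ^ 2 * ξ ^ 2 : ℝ) : ℂ) * ∫ s, 𝓕 (fun x => (K s x : ℂ)) ξ ∂m := by
  set w := 2 * Real.pi * ξ with hw
  have hb : ∀ (c y : ℝ), c = w ∨ c = w ^ 2 ∨ c = 1 → |y| ≤ 1 → |c * y| ≤ 1 + |w| + w ^ 2 := by
    intro c y hc hy
    rw [abs_mul]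
    have : |c| * |y| ≤ |c| * 1 := by gcongr
    rcases hc with rfl | rfl | rfl
    · nlinarith [sq_nonneg w]
    · rw [abs_of_nonneg (sq_nonneg w)] at *
      linarith [abs_nonneg w]
    · rw [abs_one] at *
      nlinarith [sq_nonneg w, abs_nonneg w]
  have hcos := forall_bounded_of_forall_compactlySupported hK h
    (f := fun x => Real.cos (w * x)) (M := 1 + |w| + w ^ 2) (by fun_prop)
    (fun x => by simpa using hb 1 _ (by simp) (Real.abs_cos_le_one (w * x)))
    (fun x => by
      rw [(deriv_deriv_cos_mul w).1, abs_neg]; exact hb _ _ (by simp) (Real.abs_sin_le_one _))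
    (fun x => by
      rw [(deriv_deriv_cos_mul w).2, abs_neg]; exact hb _ _ (by simp) (Real.abs_cos_le_one _))
  have hsin := forall_bounded_of_forall_compactlySupported hK h
    (f := fun x => Real.sin (w * x)) (M := 1 + |w| + w ^ 2) (by fun_prop)
    (fun x => by simpa using hb 1 _ (by simp) (Real.abs_sin_le_one (w * x)))
    (fun x => by
      rw [(deriv_deriv_sin_mul w).1]; exact hb _ _ (by simp) (Real.abs_cos_le_one _))
    (fun x => by
      rw [(deriv_deriv_sin_mul w).2, abs_neg]; exact hb _ _ (by simp) (Real.abs_sin_le_one _))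
  have hi : ∀ f : ℝ → ℝ, Continuous f → (∀ x, |f x| ≤ 1) →
      Integrable (fun s => ∫ x, f x * K s x) m := fun f hf hC =>
    (hK.bdd_mul (f := fun q : ℝ × ℝ => f q.2) (hf.comp continuous_snd).aestronglyMeasurable
      (Filter.Eventually.of_forall fun q => hC q.2)).integral_prod_left
  have hic := hi (fun x => Real.cos (w * x)) (by fun_prop) fun x => Real.abs_cos_le_one _
  have his := hi (fun x => Real.sin (w * x)) (by fun_prop) fun x => Real.abs_sin_le_one _
  have hF : ∫ s, 𝓕 (fun x => (K s x : ℂ)) ξ ∂m =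
      ((∫ s, (∫ x, Real.cos (w * x) * K s x) ∂m : ℝ) : ℂ) -
        Complex.I * ((∫ s, (∫ x, Real.sin (w * x) * K s x) ∂m : ℝ) : ℂ) := by
    rw [← integral_complex_ofReal, ← integral_complex_ofReal, ← integral_const_mul,
      ← integral_sub hic.ofReal (his.ofReal.const_mul _)]
    refine integral_congr_ae ?_
    filter_upwards [hK.prod_right_ae] with s hs
    exact fourier_ofReal_eq_cos_sub_sin hs ξ
  simp only [(deriv_deriv_cos_mul w).2, neg_mul, mul_assoc, integral_neg, integral_const_mul]
    at hcos
  simp only [(deriv_deriv_sin_mul w).2, neg_mul, mul_assoc, integral_neg, integral_const_mul]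
    at hsin
  have hw2 : 4 * Real.pi ^ 2 * ξ ^ 2 = w ^ 2 := by rw [hw]; ring
  have hcos' := congrArg (fun r : ℝ => (r : ℂ)) hcos
  have hsin' := congrArg (fun r : ℝ => (r : ℂ)) hsin
  push_cast at hcos' hsin'
  rw [hF, signedFourier_eq, signedFourier_eq, ← hw, hw2]
  push_cast
  linear_combination hcos' - Complex.I * hsin'

theorem exists_kernel_jordan_of_continuousOn {T : ℝ} (hT : 0 ≤ T) {z : ℝ → SignedMeasure ℝ}
    (hz : ∀ φ : ℝ →ᵇ ℝ, ContinuousOn (fun t => sintegral (z t) φ) (Icc 0 T)) :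
    ∃ (P N : Kernel ℝ ℝ) (C : ℝ), IsFiniteKernel P ∧ IsFiniteKernel N ∧
      (∀ t ∈ Icc 0 T, P t = (z t).toJordanDecomposition.posPart) ∧
      (∀ t ∈ Icc 0 T, N t = (z t).toJordanDecomposition.negPart) ∧
      ∀ t ∈ Icc 0 T, ∀ φ : ℝ →ᵇ ℝ, |sintegral (z t) φ| ≤ C * ‖φ‖ := by
  have hcont : ∀ φ : ℝ →ᵇ ℝ, Continuous fun t => sintegral (z (projIcc 0 T hT t)) φ := fun φ =>
    (hz φ).comp_continuous (continuous_subtype_val.comp continuous_projIcc)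
      fun t => (projIcc 0 T hT t).2
  obtain ⟨C, hC0, hC⟩ := exists_bound_sintegral (z := fun t => z (projIcc 0 T hT t)) fun φ => by
    obtain ⟨C, hC⟩ := isCompact_Icc.exists_bound_of_continuousOn (hz φ)
    exact ⟨C, fun t => hC _ (projIcc 0 T hT t).2⟩
  obtain ⟨P, N, hPf, hNf, hP, hN⟩ := exists_kernel_jordan hcont hC0 hC
  refine ⟨P, N, C, hPf, hNf, fun t ht => ?_, fun t ht => ?_, fun t ht φ => ?_⟩
  · rw [hP, projIcc_of_mem hT ht]
  · rw [hN, projIcc_of_mem hT ht]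
  · simpa only [projIcc_of_mem hT ht] using hC t φ

/-- The cosine of frequency `w` as a bounded continuous function. -/
noncomputable def cosBCF (w : ℝ) : ℝ →ᵇ ℝ :=
  BoundedContinuousFunction.ofNormedAddCommGroup (fun x => Real.cos (w * x)) (by fun_prop) 1
    fun _ => Real.abs_cos_le_one _

/-- The sine of frequency `w` as a bounded continuous function. -/
noncomputable def sinBCF (w : ℝ) : ℝ →ᵇ ℝ :=
  BoundedContinuousFunction.ofNormedAddCommGroup (fun x => Real.sin (w * x)) (by fun_prop) 1
    fun _ => Real.abs_sin_le_one _

theorem cosBCF_apply (w x : ℝ) : cosBCF w x = Real.cos (w * x) := rfl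

theorem sinBCF_apply (w x : ℝ) : sinBCF w x = Real.sin (w * x) := rfl

theorem norm_cosBCF_le (w : ℝ) : ‖cosBCF w‖ ≤ 1 :=
  BoundedContinuousFunction.norm_ofNormedAddCommGroup_le _ zero_le_one _

theorem norm_sinBCF_le (w : ℝ) : ‖sinBCF w‖ ≤ 1 :=
  BoundedContinuousFunction.norm_ofNormedAddCommGroup_le _ zero_le_one _

theorem signedFourier_eq_sintegral (μ : SignedMeasure ℝ) (ξ : ℝ) :
    signedFourier μ ξ = (sintegral μ (cosBCF (2 * Real.pi * ξ)) : ℂ) -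
      Complex.I * (sintegral μ (sinBCF (2 * Real.pi * ξ)) : ℂ) :=
  signedFourier_eq μ ξ

theorem norm_signedFourier_le {μ : SignedMeasure ℝ} {C : ℝ}
    (hC : ∀ φ : ℝ →ᵇ ℝ, |sintegral μ φ| ≤ C * ‖φ‖) (ξ : ℝ) : ‖signedFourier μ ξ‖ ≤ 2 * |C| := by
  have h : ∀ φ : ℝ →ᵇ ℝ, ‖φ‖ ≤ 1 → |sintegral μ φ| ≤ |C| := fun φ hφ =>
    calc |sintegral μ φ| ≤ C * ‖φ‖ := hC φ
      _ ≤ |C| * 1 := mul_le_mul (le_abs_self C) hφ (norm_nonneg _) (abs_nonneg _)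
      _ = |C| := mul_one _
  rw [signedFourier_eq_sintegral]
  refine (norm_sub_le _ _).trans ?_
  rw [norm_mul, Complex.norm_I, one_mul, Complex.norm_real, Complex.norm_real, Real.norm_eq_abs,
    Real.norm_eq_abs]
  linarith [h _ (norm_cosBCF_le (2 * Real.pi * ξ)), h _ (norm_sinBCF_le (2 * Real.pi * ξ))]

theorem continuousOn_signedFourier {S : Set ℝ} {z : ℝ → SignedMeasure ℝ}
    (hz : ∀ φ : ℝ →ᵇ ℝ, ContinuousOn (fun t => sintegral (z t) φ) S) (ξ : ℝ) :
    ContinuousOn (fun t => signedFourier (z t) ξ) S := by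
  simp only [signedFourier_eq_sintegral]
  exact (Complex.continuous_ofReal.comp_continuousOn (hz _)).sub
    (continuousOn_const.mul (Complex.continuous_ofReal.comp_continuousOn (hz _)))

theorem signedFourier_sub_eq_fourier {μ₁ μ₂ : SignedMeasure ℝ} {u : ℝ → ℝ}
    (hum : Measurable u) (hu : Integrable u)
    (h : ∀ A : Set ℝ, MeasurableSet A → (μ₁ - μ₂) A = ∫ x in A, u x) (ξ : ℝ) :
    signedFourier μ₁ ξ - signedFourier μ₂ ξ = 𝓕 (fun x => (u x : ℂ)) ξ := by
  have hc := congrArg (fun r : ℝ => (r : ℂ))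
    (sintegral_sub_sintegral_eq_integral hum hu h (cosBCF (2 * Real.pi * ξ)))
  have hs := congrArg (fun r : ℝ => (r : ℂ))
    (sintegral_sub_sintegral_eq_integral hum hu h (sinBCF (2 * Real.pi * ξ)))
  have e := fourier_ofReal_eq_cos_sub_sin hu ξ
  rw [e, signedFourier_eq_sintegral, signedFourier_eq_sintegral]
  simp only [cosBCF_apply, sinBCF_apply, Complex.ofReal_sub] at hc hs
  linear_combination hc - Complex.I * hs

/-- Integration of Schwartz functions against a finite signed measure. -/
noncomputable def sintegralLinearMap (μ : SignedMeasure ℝ) : SchwartzMap ℝ ℝ →ₗ[ℝ] ℝ where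
  toFun φ := sintegral μ φ
  map_add' φ ψ := by
    have h : ∀ (φ : SchwartzMap ℝ ℝ) (ν : Measure ℝ) [IsFiniteMeasure ν], Integrable φ ν :=
      fun φ ν _ => φ.toBoundedContinuousFunction.integrable ν
    have e : ∀ (ν : Measure ℝ) [IsFiniteMeasure ν],
        ∫ x, (φ + ψ) x ∂ν = ∫ x, φ x ∂ν + ∫ x, ψ x ∂ν := fun ν _ =>
      integral_add (h φ ν) (h ψ ν)
    rw [sintegral, sintegral, sintegral, e, e]
    ring
  map_smul' c φ := by
    have e : ∀ ν : Measure ℝ, ∫ x, (c • φ) x ∂ν = c * ∫ x, φ x ∂ν := fun ν =>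
      integral_const_mul c φ
    rw [sintegral, sintegral, e, e, RingHom.id_apply, smul_eq_mul]
    ring

theorem integrable_of_lintegral_Icc_lt_top {τ T : ℝ} {f : ℝ × ℝ → ℝ} (hf : Measurable f)
    (h0 : ∀ q, 0 ≤ f q)
    (h : ∫⁻ q in Icc τ T ×ˢ (univ : Set ℝ), ENNReal.ofReal (f q) < ⊤) :
    Integrable f ((volume.restrict (Ioc τ T)).prod volume) := by
  have e : (volume.restrict (Icc τ T)).prod (volume : Measure ℝ) =
      volume.restrict (Icc τ T ×ˢ (univ : Set ℝ)) := by
    rw [Measure.volume_eq_prod, ← Measure.prod_restrict, Measure.restrict_univ]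
  rw [restrict_Ioc_eq_restrict_Icc, e]
  exact ⟨hf.aestronglyMeasurable,
    (hasFiniteIntegral_iff_ofReal (Filter.Eventually.of_forall h0)).2 h⟩

theorem ae_integrableOn_Icc_of_locallyIntegrableOn {T : ℝ} {g : ℝ → ℝ → ℝ}
    (hg : LocallyIntegrableOn (fun q : ℝ × ℝ => g q.1 q.2) (Icc (0 : ℝ) T ×ˢ (univ : Set ℝ))) :
    ∀ᵐ s ∂volume.restrict (Ioc 0 T), ∀ n : ℕ, IntegrableOn (g s) (Icc (-(n : ℝ)) n) := by
  rw [ae_all_iff]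
  intro n
  have h := hg.integrableOn_compact_subset (prod_mono_right (subset_univ (Icc (-(n : ℝ)) n)))
    (isCompact_Icc.prod isCompact_Icc)
  rw [IntegrableOn, Measure.volume_eq_prod, ← Measure.prod_restrict,
    ← restrict_Ioc_eq_restrict_Icc] at h
  exact h.prod_right_ae

end FokkerPlanckUniqueness

/-- uniqueness for the one-dimensional Fokker-Planck equation ∂_t z = ∂²_{xx}(a z)
under Hypothesis (B2): the difference of two weakly continuous measure-valued distributional
solutions with the same initial condition admits a density g ∈ L¹_loc([0,T]×ℝ) such that for
every t₀ > 0: (i) ∫_{[t₀,T]×ℝ}|g|² < ∞, (ii) ∫_{[0,T]×ℝ}|a g| < ∞, (iii) ∫_{[t₀,T]×ℝ}|a g|² < ∞;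
then the two solutions coincide for every t ∈ [0,T]. -/
theorem fokkerPlanck_uniqueness_dim_one
    (T : ℝ) (hT : 0 < T)
    (a : ℝ → ℝ → ℝ)
    (ha_meas : Measurable (Function.uncurry a))
    (ha_nonneg : ∀ t x, 0 ≤ a t x)
    (z₁ z₂ : ℝ → MeasureTheory.SignedMeasure ℝ)
    (z0 : MeasureTheory.SignedMeasure ℝ)
    -- weak continuity of t ↦ z₁ t, z₂ t on [0,T]
    (hz₁cont : ∀ φ : BoundedContinuousFunction ℝ ℝ,
      ContinuousOn (fun t => sintegral (z₁ t) φ) (Icc 0 T))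
    (hz₂cont : ∀ φ : BoundedContinuousFunction ℝ ℝ,
      ContinuousOn (fun t => sintegral (z₂ t) φ) (Icc 0 T))
    -- both solve ∂_t z = ∂²_{xx}(a z) in the sense of distributions with initial condition z⁰
    (hz₁sol : ∀ φ : SchwartzMap ℝ ℝ, ∀ t ∈ Icc (0:ℝ) T,
      sintegral (z₁ t) φ
        = sintegral z0 φ
          + ∫ s in (0:ℝ)..t, sintegral (z₁ s) (fun x => deriv (deriv φ) x * a s x))
    (hz₂sol : ∀ φ : SchwartzMap ℝ ℝ, ∀ t ∈ Icc (0:ℝ) T,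
      sintegral (z₂ t) φ
        = sintegral z0 φ
          + ∫ s in (0:ℝ)..t, sintegral (z₂ s) (fun x => deriv (deriv φ) x * a s x))
    -- Hypothesis (B): z := z₁ - z₂ has a density g(t,·) for a.e. t, with g ∈ L¹_loc
    (g : ℝ → ℝ → ℝ)
    (hg_meas : Measurable (Function.uncurry g))
    (hg_dens : ∀ᵐ t ∂(volume.restrict (Icc (0:ℝ) T)),
      ∀ A : Set ℝ, MeasurableSet A → (z₁ t - z₂ t) A = ∫ x in A, g t x)
    (hg_loc : LocallyIntegrableOn (fun q : ℝ × ℝ => g q.1 q.2)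
      (Icc (0:ℝ) T ×ˢ (univ : Set ℝ)))
    -- (B2)(i): ∫_{[t₀,T]×ℝ} |z|² < ∞ for every t₀ > 0
    (hB2i : ∀ t₀ : ℝ, 0 < t₀ →
      ∫⁻ q in Icc t₀ T ×ˢ (univ : Set ℝ), ENNReal.ofReal ((g q.1 q.2) ^ 2) < ⊤)
    -- (B2)(ii): ∫_{[0,T]×ℝ} |a z| < ∞
    (hB2ii : ∫⁻ q in Icc (0:ℝ) T ×ˢ (univ : Set ℝ),
        ENNReal.ofReal (|a q.1 q.2 * g q.1 q.2|) < ⊤)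
    -- (B2)(iii): ∫_{[t₀,T]×ℝ} |a z|² < ∞ for every t₀ > 0
    (hB2iii : ∀ t₀ : ℝ, 0 < t₀ →
      ∫⁻ q in Icc t₀ T ×ˢ (univ : Set ℝ),
        ENNReal.ofReal ((a q.1 q.2 * g q.1 q.2) ^ 2) < ⊤) :
    ∀ t ∈ Icc (0:ℝ) T, z₁ t = z₂ t := by
  set m : Measure ℝ := volume.restrict (Ioc 0 T) with hm
  obtain ⟨P₁, N₁, C₁, _, _, hP₁, hN₁, hC₁⟩ := exists_kernel_jordan_of_continuousOn hT.le hz₁cont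
  obtain ⟨P₂, N₂, C₂, _, _, hP₂, hN₂, hC₂⟩ := exists_kernel_jordan_of_continuousOn hT.le hz₂cont
  have hmem : ∀ᵐ s ∂m, s ∈ Icc 0 T :=
    (ae_restrict_mem measurableSet_Ioc).mono fun s hs => Ioc_subset_Icc_self hs
  have hdens : ∀ᵐ s ∂m, ∀ A : Set ℝ, MeasurableSet A → (z₁ s - z₂ s) A = ∫ x in A, g s x := by
    rw [hm, restrict_Ioc_eq_restrict_Icc]
    exact hg_dens
  have hgs : ∀ s, Measurable (g s) := fun s => hg_meas.comp measurable_prodMk_left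
  have hgint : ∀ᵐ s ∂m, Integrable (g s) := by
    filter_upwards [hdens, ae_integrableOn_Icc_of_locallyIntegrableOn hg_loc] with s h1 h2
    exact integrable_of_signedMeasure_apply_eq (hgs s) h2 h1
  have hagm : Measurable fun q : ℝ × ℝ => a q.1 q.2 * g q.1 q.2 := ha_meas.mul hg_meas
  have hag : Integrable (fun q : ℝ × ℝ => a q.1 q.2 * g q.1 q.2) (m.prod volume) :=
    (integrable_norm_iff hagm.aestronglyMeasurable).1
      (integrable_of_lintegral_Icc_lt_top hagm.norm (fun _ => norm_nonneg _) hB2ii)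
  have hprop := (hmem.and (hdens.and hgint)).mono fun s hs =>
    kernelDensity_properties (hP₁ s hs.1) (hN₁ s hs.1) (hP₂ s hs.1) (hN₂ s hs.1) (hgs s)
      hs.2.2 hs.2.1
  obtain ⟨E, E', hE, hE', hdich⟩ := dichotomy_of_kernels ha_meas hg_meas
    (measurable_kernelDensity P₁ P₂) (measurable_kernelDensity N₁ N₂) hag
    (hprop.mono fun s hs => hs.1.mono fun x hx => ⟨hx.1, hx.2.2.2.1⟩)
    (hprop.mono fun s hs f hf hfg => (hs.2 f hf hfg).1)
    (hprop.mono fun s hs f hf hfg => (hs.2 f hf hfg).2)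
    (z := fun t => sintegralLinearMap (z₁ t) - sintegralLinearMap (z₂ t)) (by
      intro t ht φ
      have e : ∀ (P N : ProbabilityTheory.Kernel ℝ ℝ) (z : ℝ → SignedMeasure ℝ),
          (∀ s ∈ Icc 0 T, P s = (z s).toJordanDecomposition.posPart) →
          (∀ s ∈ Icc 0 T, N s = (z s).toJordanDecomposition.negPart) →
          ∫ s in (0 : ℝ)..t, sintegral (z s) (fun x => deriv (deriv φ) x * a s x) =
            ∫ s in (0 : ℝ)..t, (∫ x, secondDeriv φ x * a s x ∂P s -
              ∫ x, secondDeriv φ x * a s x ∂N s) := by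
        intro P N z hP hN
        refine intervalIntegral.integral_congr fun s hs => ?_
        rw [uIcc_of_le ht.1] at hs
        have hs' : s ∈ Icc 0 T := ⟨hs.1, hs.2.trans ht.2⟩
        simp only [hP s hs', hN s hs', sintegral, secondDeriv_apply]
      rw [← e P₁ N₁ z₁ hP₁ hN₁, ← e P₂ N₂ z₂ hP₂ hN₂]
      change sintegral (z₁ t) φ - sintegral (z₂ t) φ = _
      rw [hz₁sol φ t ht, hz₂sol φ t ht]
      ring)
  set K := gatedDensity a (kernelDensity P₁ P₂) (kernelDensity N₁ N₂) E E' with hKdef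
  have hKm : Measurable (Function.uncurry K) := measurable_gatedDensity ha_meas
    (measurable_kernelDensity P₁ P₂) (measurable_kernelDensity N₁ N₂) hE hE'
  have hKle : ∀ᵐ s ∂m, ∀ᵐ x, |K s x| ≤ 2 * |a s x * g s x| := by
    filter_upwards [hprop] with s hs
    filter_upwards [hs.1] with x hx
    exact abs_gatedDensity_le hx.1 hx.2.2.2.1
  have hK1 : Integrable (fun q : ℝ × ℝ => K q.1 q.2) (m.prod volume) :=
    integrable_of_ae_ae_le hKm (hagm.norm.const_mul 2) (hag.norm.const_mul 2) hKle
  have hF : ∀ s ∈ Icc 0 T, (∀ ξ, signedFourier (z₁ s) ξ - signedFourier (z₂ s) ξ = 0) ∨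
      ∀ ξ, signedFourier (z₁ s) ξ - signedFourier (z₂ s) ξ =
        -((4 * Real.pi ^ 2 * ξ ^ 2 : ℝ) : ℂ) *
          ∫ r in 0..s, FourierTransform.fourier (fun x => (K r x : ℂ)) ξ := by
    intro s hs
    refine (hdich s hs).imp (fun h ξ => ?_) fun h ξ => ?_
    · have := signedFourier_sub_eq (m := m) (K := fun _ _ => 0) (by simp) (μ₁ := z₁ s)
        (μ₂ := z₂ s) (fun φ hφ => Eq.trans (h φ hφ) (by simp)) ξ
      simpa [Real.fourier_eq] using this
    · rw [intervalIntegral.integral_of_le hs.1]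
      refine signedFourier_sub_eq (hK1.mono_measure (Measure.prod_mono
        (Measure.restrict_mono (Ioc_subset_Ioc_right hs.2) le_rfl) le_rfl)) (fun φ hφ => ?_) ξ
      rw [← intervalIntegral.integral_of_le hs.1]
      exact h φ hφ
  have hzero := energy_uniqueness_of_dichotomy hg_meas hKm hK1 hgint
    (fun τ hτ => integrable_of_lintegral_Icc_lt_top (hg_meas.pow_const 2)
      (fun _ => sq_nonneg _) (hB2i τ hτ))
    (fun τ hτ => by
      refine integrable_of_ae_ae_le (hKm.pow_const 2) ((hagm.pow_const 2).const_mul 4)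
        ((integrable_of_lintegral_Icc_lt_top (hagm.pow_const 2)
          (fun _ => sq_nonneg _) (hB2iii τ hτ)).const_mul 4) ?_
      filter_upwards [ae_restrict_of_ae_restrict_of_subset (Ioc_subset_Ioc_left hτ.le) hKle]
        with s hs
      filter_upwards [hs] with x hx
      rw [abs_of_nonneg (sq_nonneg _), ← sq_abs (K s x), ← sq_abs (a s x * g s x)]
      nlinarith [abs_nonneg (K s x)])
    (by
      filter_upwards [hprop] with s hs
      filter_upwards [hs.1] with x hx
      have h1 : 0 ≤ E.indicator (fun _ => kernelDensity P₁ P₂ s x) s * g s x := by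
        by_cases h : s ∈ E <;> simp [h, hx.2.1]
      have h2 : E'.indicator (fun _ => kernelDensity N₁ N₂ s x) s * g s x ≤ 0 := by
        by_cases h : s ∈ E' <;> simp [h, hx.2.2.2.2]
      rw [hKdef, gatedDensity, mul_assoc, sub_mul]
      exact mul_nonneg (ha_nonneg s x) (by linarith))
    (Z := fun s ξ => signedFourier (z₁ s) ξ - signedFourier (z₂ s) ξ)
    (C := 2 * |C₁| + 2 * |C₂|)
    (fun s hs ξ => (norm_sub_le _ _).trans
      (add_le_add (norm_signedFourier_le (hC₁ s hs) ξ) (norm_signedFourier_le (hC₂ s hs) ξ)))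
    (fun ξ => (continuousOn_signedFourier hz₁cont ξ).sub (continuousOn_signedFourier hz₂cont ξ))
    (fun s _ => (continuous_signedFourier _).sub (continuous_signedFourier _))
    (fun ξ => by
      rcases hF 0 (left_mem_Icc.2 hT.le) with h | h
      · exact h ξ
      · simpa using h ξ)
    hF
    (by
      filter_upwards [hdens, hgint] with s h1 h2 ξ
      exact signedFourier_sub_eq_fourier (hgs s) h2 h1 ξ)
  exact fun t ht => eq_of_signedFourier_eq fun ξ => sub_eq_zero.1 (hzero t ht ξ)
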